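/- arXiv:1505.06439 — 3 statements merged into one kernel-verified Lean document; each statement's English description precedes it below -/
import Mathlib

section
/- Let D̄ denote the closed unit disk in ℝ² with boundary circle S¹, and let h : D̄ → D̄ be a monotone map. Then h maps S¹ onto S¹ (that is, h(S¹) = S¹), and the restriction of h to S¹, regarded as a map h : S¹ → S¹, is monotone: it is a continuous surjection of S¹ onto S¹ and for every b ∈ S¹ the set h⁻¹({b}) ∩ S¹ is a connected subset of S¹. -/
open Set Topology Complex

/-- `f` has a continuous logarithm on `s`. -/
def HasLogOn {X : Type*} [TopologicalSpace X] (f : X → ℂ) (s : Set X) : Prop :=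
  ∃ Φ : X → ℂ, ContinuousOn Φ s ∧ ∀ x ∈ s, exp (Φ x) = f x

section Logarithms

variable {X : Type*} [TopologicalSpace X] {f g : X → ℂ} {s t : Set X}

theorem HasLogOn.mono (hf : HasLogOn f t) (hst : s ⊆ t) : HasLogOn f s := by
  obtain ⟨Φ, hΦ, he⟩ := hf
  exact ⟨Φ, hΦ.mono hst, fun x hx => he x (hst hx)⟩

theorem HasLogOn.of_subsingleton (hs : s.Subsingleton) (hf : ∀ x ∈ s, f x ≠ 0) :
    HasLogOn f s :=
  ⟨fun x => log (f x), hs.continuousOn _, fun x hx => exp_log (hf x hx)⟩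

/-- Two continuous logarithms on a preconnected set differ by a constant. -/
theorem sub_eq_sub_of_exp_eq {Φ Ψ : X → ℂ} (hs : IsPreconnected s) (hΦ : ContinuousOn Φ s)
    (hΨ : ContinuousOn Ψ s) (h : ∀ x ∈ s, exp (Φ x) = exp (Ψ x)) {x y : X} (hx : x ∈ s)
    (hy : y ∈ s) : Φ x - Ψ x = Φ y - Ψ y := by
  have key : ∀ z ∈ s, ∃ n : ℤ, Φ z - Ψ z = n * (2 * Real.pi * I) := by
    intro z hz
    obtain ⟨n, hn⟩ := exp_eq_exp_iff_exists_int.1 (h z hz)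
    exact ⟨n, by rw [hn]; ring⟩
  have hpi : (2 * Real.pi : ℝ) ≠ 0 := by positivity
  have hc : ContinuousOn (fun z => (Φ z - Ψ z).im / (2 * Real.pi)) s :=
    ((continuous_im.comp_continuousOn (hΦ.sub hΨ))).div_const _
  have hm : MapsTo (fun z => (Φ z - Ψ z).im / (2 * Real.pi)) s (range ((↑) : ℤ → ℝ)) := by
    intro z hz
    obtain ⟨n, hn⟩ := key z hz
    refine ⟨n, ?_⟩
    simp only [hn]
    rw [eq_div_iff hpi]
    simp
  have : DiscreteTopology (range ((↑) : ℤ → ℝ)) :=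
    (Int.isClosedEmbedding_coe_real.isEmbedding.toHomeomorph).symm.isEmbedding.discreteTopology
  have hxy := hs.constant_of_mapsTo ⟨this⟩ hc hm hx hy
  obtain ⟨m, hm'⟩ := key x hx
  obtain ⟨n, hn'⟩ := key y hy
  simp only [hm', hn'] at hxy ⊢
  rw [div_left_inj' hpi] at hxy
  simp at hxy
  rw [hxy]

theorem HasLogOn.of_div_mem_slitPlane (hg : HasLogOn g s) (hf : ContinuousOn f s)
    (hgc : ContinuousOn g s) (h : ∀ x ∈ s, f x / g x ∈ slitPlane) : HasLogOn f s := by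
  obtain ⟨Φ, hΦ, he⟩ := hg
  have hg0 : ∀ x ∈ s, g x ≠ 0 := fun x hx => he x hx ▸ exp_ne_zero _
  refine ⟨fun x => Φ x + log (f x / g x), hΦ.add ((hf.div hgc hg0).clog h), fun x hx => ?_⟩
  rw [exp_add, he x hx, exp_log (slitPlane_ne_zero (h x hx)), mul_div_cancel₀ _ (hg0 x hx)]

/-- Continuous logarithms on two closed sets with preconnected intersection can be glued. -/
theorem HasLogOn.union (hs : IsClosed s) (ht : IsClosed t) (hst : IsPreconnected (s ∩ t))
    (hfs : HasLogOn f s) (hft : HasLogOn f t) : HasLogOn f (s ∪ t) := by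
  classical
  obtain ⟨Φ, hΦ, hΦe⟩ := hfs
  obtain ⟨Ψ, hΨ, hΨe⟩ := hft
  obtain ⟨c, hc, hc'⟩ : ∃ c : ℂ, exp c = 1 ∧ ∀ x ∈ s ∩ t, Φ x = Ψ x + c := by
    rcases (s ∩ t).eq_empty_or_nonempty with h0 | ⟨y, hy⟩
    · exact ⟨0, exp_zero, by simp [h0]⟩
    · refine ⟨Φ y - Ψ y, ?_, fun x hx => ?_⟩
      · rw [exp_sub, hΦe y hy.1, hΨe y hy.2, div_self]
        exact hΦe y hy.1 ▸ exp_ne_zero _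
      · rw [← sub_eq_sub_of_exp_eq hst (hΦ.mono inter_subset_left) (hΨ.mono inter_subset_right)
          (fun x hx => (hΦe x hx.1).trans (hΨe x hx.2).symm) hx hy]
        ring
  have e1 : ∀ x ∈ s, s.piecewise Φ (fun x => Ψ x + c) x = Φ x := fun x hx =>
    piecewise_eq_of_mem _ _ _ hx
  have e2 : ∀ x ∈ t, s.piecewise Φ (fun x => Ψ x + c) x = Ψ x + c := by
    intro x hx
    by_cases hxs : x ∈ s
    · rw [e1 x hxs, hc' x ⟨hxs, hx⟩]
    · exact piecewise_eq_of_notMem _ _ _ hxs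
  refine ⟨s.piecewise Φ (fun x => Ψ x + c), ?_, ?_⟩
  · exact (hΦ.congr e1).union_of_isClosed ((hΨ.add continuousOn_const).congr e2) hs ht
  · rintro x (hx | hx)
    · rw [e1 x hx, hΦe x hx]
    · rw [e2 x hx, exp_add, hc, mul_one, hΨe x hx]

/-- A continuous logarithm on a closed set extends to a neighbourhood. -/
theorem HasLogOn.exists_isOpen [NormalSpace X] (hf : Continuous f) (hs : IsClosed s)
    (h : HasLogOn f s) : ∃ u, IsOpen u ∧ s ⊆ u ∧ HasLogOn f u := by
  obtain ⟨Φ, hΦ, he⟩ := h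
  obtain ⟨Ψ, hΨ⟩ := ContinuousMap.exists_restrict_eq hs ⟨_, hΦ.domRestrict⟩
  have hΨ' : ∀ x ∈ s, Ψ x = Φ x := fun x hx => DFunLike.congr_fun hΨ ⟨x, hx⟩
  have hexp : Continuous fun x => exp (Ψ x) := continuous_exp.comp Ψ.continuous
  have hq : Continuous fun x => f x / exp (Ψ x) := hf.div hexp fun x => exp_ne_zero _
  refine ⟨_, isOpen_slitPlane.preimage hq, fun x hx => ?_, ?_⟩
  · simp [hΨ' x hx, he x hx, div_self (he x hx ▸ exp_ne_zero _ : f x ≠ 0), one_mem_slitPlane]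
  · exact HasLogOn.of_div_mem_slitPlane ⟨Ψ, Ψ.continuous.continuousOn, fun _ _ => rfl⟩
      hf.continuousOn hexp.continuousOn fun x hx => hx

/-- If `f` has a continuous logarithm on every fibre in `k` of a real function `p` and these fibres
are preconnected, then `f` has a continuous logarithm on `k`. -/
theorem HasLogOn.of_fibers [CompactSpace X] [T2Space X] {k : Set X} {p : X → ℝ} (hf : Continuous f)
    (hk : IsClosed k) (hp : Continuous p) (hconn : ∀ t, IsPreconnected (k ∩ p ⁻¹' {t}))
    (hlog : ∀ t, HasLogOn f (k ∩ p ⁻¹' {t})) : HasLogOn f k := by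
  have hloc : ∀ t, ∃ ε > 0, HasLogOn f (k ∩ p ⁻¹' Icc (t - ε) (t + ε)) := by
    intro t
    obtain ⟨u, huo, hsu, hu⟩ := (hlog t).exists_isOpen hf
      (hk.inter (isClosed_singleton.preimage hp))
    have hcl : IsClosed (p '' (k \ u)) :=
      ((hk.sdiff huo).isCompact.image hp).isClosed
    have ht : (p '' (k \ u))ᶜ ∈ 𝓝 t := by
      refine hcl.isOpen_compl.mem_nhds ?_
      rintro ⟨x, hx, rfl⟩
      exact hx.2 (hsu ⟨hx.1, rfl⟩)
    obtain ⟨ε, hε, hb⟩ := Metric.nhds_basis_closedBall.mem_iff.1 ht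
    refine ⟨ε, hε, hu.mono fun x hx => ?_⟩
    by_contra hxu
    refine hb ?_ ⟨x, ⟨hx.1, hxu⟩, rfl⟩
    rw [Real.closedBall_eq_Icc]
    exact hx.2
  obtain ⟨a, ha⟩ := (isCompact_range hp).bddBelow
  obtain ⟨b, hb⟩ := (isCompact_range hp).bddAbove
  set S : Set ℝ := {t | HasLogOn f (k ∩ p ⁻¹' Iic t)} with hS
  by_contra hcon
  have hSb : ∀ t ∈ S, t ≤ b := by
    intro t ht
    by_contra! hbt
    exact hcon (HasLogOn.mono ht fun x hx => ⟨hx, (hb ⟨x, rfl⟩).trans hbt.le⟩)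
  have hSa : a - 1 ∈ S := by
    refine HasLogOn.of_subsingleton (s := _) ?_ ?_ <;>
    · rintro x ⟨-, hx⟩
      have h1 : p x ≤ a - 1 := hx
      have h2 : a ≤ p x := ha ⟨x, rfl⟩
      linarith
  obtain ⟨ε, hε, hl⟩ := hloc (sSup S)
  obtain ⟨t, htS, ht⟩ := exists_lt_of_lt_csSup ⟨_, hSa⟩ (sub_lt_self (sSup S) hε)
  have htle : t ≤ sSup S := le_csSup ⟨b, hSb⟩ htS
  have hmem : sSup S + ε ∈ S := by
    have h1 : HasLogOn f (k ∩ p ⁻¹' Icc t (sSup S + ε)) :=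
      hl.mono fun x hx => ⟨hx.1, ht.le.trans hx.2.1, hx.2.2⟩
    have h2 : k ∩ p ⁻¹' Iic (sSup S + ε) = (k ∩ p ⁻¹' Iic t) ∪ (k ∩ p ⁻¹' Icc t (sSup S + ε)) := by
      ext x
      simp only [mem_inter_iff, mem_preimage, mem_Iic, mem_union, mem_Icc]
      have := le_total (p x) t
      grind
    have h3 : (k ∩ p ⁻¹' Iic t) ∩ (k ∩ p ⁻¹' Icc t (sSup S + ε)) = k ∩ p ⁻¹' {t} := by
      ext x
      simp only [mem_inter_iff, mem_preimage, mem_Iic, mem_Icc, mem_singleton_iff]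
      grind
    change HasLogOn f _
    rw [h2]
    exact HasLogOn.union (hk.inter (isClosed_Iic.preimage hp)) (hk.inter (isClosed_Icc.preimage hp))
      (h3 ▸ hconn t) htS h1
  have := le_csSup ⟨b, hSb⟩ hmem
  linarith

end Logarithms

/-- The preimage of a preconnected set under a closed map with connected fibres is preconnected. -/
theorem IsPreconnected.preimage_of_connected_fibers {X Y : Type*} [TopologicalSpace X]
    [TopologicalSpace Y] {h : X → Y} (hc : Continuous h) (hcl : IsClosedMap h)
    (hfib : ∀ y, IsConnected (h ⁻¹' {y})) {s : Set Y} (hs : IsPreconnected s) :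
    IsPreconnected (h ⁻¹' s) := by
  have hsurj : Function.Surjective h := fun y => (hfib y).nonempty
  have hq : IsQuotientMap (s.restrictPreimage h) :=
    (hcl.restrictPreimage s).isQuotientMap hc.restrictPreimage (hsurj.restrictPreimage s)
  rcases s.eq_empty_or_nonempty with rfl | hne
  · simpa using isPreconnected_empty
  have hfib' : ∀ y : s, IsConnected (s.restrictPreimage h ⁻¹' {y}) := by
    intro y
    have himg : Subtype.val '' (s.restrictPreimage h ⁻¹' {y}) = h ⁻¹' {y.1} := by
      ext x
      constructor
      · rintro ⟨z, hz, rfl⟩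
        exact congrArg Subtype.val hz
      · intro hx
        have hxs : x ∈ h ⁻¹' s := by
          rw [mem_preimage, show h x = y from hx]
          exact y.2
        exact ⟨⟨x, hxs⟩, Subtype.ext hx, rfl⟩
    refine ⟨?_, IsInducing.subtypeVal.isPreconnected_image.1 (himg ▸ (hfib y).isPreconnected)⟩
    exact image_nonempty.1 (himg ▸ (hfib y).nonempty)
  have huniv : IsConnected (univ : Set s) :=
    ⟨hne.to_subtype.elim fun y => ⟨y, mem_univ y⟩,
      (isPreconnected_iff_preconnectedSpace.1 hs).isPreconnected_univ⟩
  have := (hq.isCoinducing.isConnected_preimage_of_isClosed hfib' isClosed_univ huniv).isPreconnected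
  simpa only [preimage_univ, image_univ, Subtype.range_coe] using
    this.image _ continuous_subtype_val.continuousOn

/-- The closed unit disk in the complex plane. -/
abbrev CDisk : Type := Metric.closedBall (0 : ℂ) 1

namespace CDisk

theorem norm_le (z : CDisk) : ‖(z : ℂ)‖ ≤ 1 := mem_closedBall_zero_iff.1 z.2

/-- The boundary point of the closed disk with angle `θ`. -/
noncomputable def bdry (θ : ℝ) : CDisk := ⟨exp (θ * I), by simp [norm_exp_ofReal_mul_I]⟩

theorem coe_bdry (θ : ℝ) : (bdry θ : ℂ) = exp (θ * I) := rfl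

theorem norm_bdry (θ : ℝ) : ‖(bdry θ : ℂ)‖ = 1 := norm_exp_ofReal_mul_I θ

theorem continuous_bdry : Continuous bdry := by
  unfold bdry
  fun_prop

theorem bdry_add_two_pi (θ : ℝ) : bdry (θ + 2 * Real.pi) = bdry θ := by
  refine Subtype.ext ?_
  rw [coe_bdry, coe_bdry]
  push_cast
  rw [add_mul, exp_add, exp_two_pi_mul_I, mul_one]

theorem bdry_ne {α β : ℝ} (h1 : α < β) (h2 : β < α + 2 * Real.pi) : bdry α ≠ bdry β := by
  intro h
  obtain ⟨n, hn⟩ := exp_eq_exp_iff_exists_int.1 (congrArg Subtype.val h)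
  have him := congrArg im hn
  simp only [mul_im, ofReal_re, ofReal_im, I_re, I_im, add_im, intCast_re, intCast_im, mul_re,
    re_ofNat, im_ofNat] at him
  ring_nf at him
  have hpi := Real.pi_pos
  have h3 : (n : ℝ) < 0 := by nlinarith
  have h4 : (-1 : ℝ) < n := by nlinarith
  have h5 : n < 0 := by exact_mod_cast h3
  have h6 : -1 < n := by exact_mod_cast h4
  omega

theorem exists_bdry_eq (α : ℝ) {z : CDisk} (hz : ‖(z : ℂ)‖ = 1) :
    ∃ θ ∈ Ico α (α + 2 * Real.pi), bdry θ = z := by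
  refine ⟨toIcoMod Real.two_pi_pos α (arg z), toIcoMod_mem_Ico _ _ _, Subtype.ext ?_⟩
  have h1 : toIcoMod Real.two_pi_pos α (arg z) =
    arg z - toIcoDiv Real.two_pi_pos α (arg z) * (2 * Real.pi) := by
    rw [toIcoMod, zsmul_eq_mul]
  rw [coe_bdry, exp_eq_exp_iff_exists_int (x := _) (y := arg (z : ℂ) * I) |>.2
    ⟨-toIcoDiv Real.two_pi_pos α (arg z), ?_⟩]
  · have := norm_mul_exp_arg_mul_I (z : ℂ)
    rwa [hz, ofReal_one, one_mul] at this
  · rw [h1]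
    push_cast
    ring

theorem isPreconnected_of_convex {s : Set ℂ} (hs : Convex ℝ s) :
    IsPreconnected ((↑) ⁻¹' s : Set CDisk) := by
  rw [← IsInducing.subtypeVal.isPreconnected_image, Subtype.image_preimage_coe]
  exact ((convex_closedBall (0 : ℂ) 1).inter hs).isPreconnected

/-- A nonvanishing continuous function on the closed disk has a continuous logarithm. -/
theorem hasLogOn_univ {f : CDisk → ℂ} (hf : Continuous f) (h0 : ∀ z, f z ≠ 0) :
    HasLogOn f univ := by
  have hre : Continuous fun z : CDisk => (z : ℂ).re := by fun_prop
  have him : Continuous fun z : CDisk => (z : ℂ).im := by fun_prop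
  have hcre : ∀ t, IsPreconnected ((fun z : CDisk => (z : ℂ).re) ⁻¹' {t}) := fun t =>
    isPreconnected_of_convex (s := {z | z.re = t}) (convex_hyperplane reLm.isLinear t)
  refine HasLogOn.of_fibers hf isClosed_univ hre (fun t => by simpa using hcre t) fun t => ?_
  rw [univ_inter]
  have hsub : ∀ u, ((fun z : CDisk => (z : ℂ).re) ⁻¹' {t} ∩
      (fun z : CDisk => (z : ℂ).im) ⁻¹' {u}).Subsingleton := by
    rintro u x ⟨hx, hx'⟩ y ⟨hy, hy'⟩
    exact Subtype.ext (Complex.ext (Eq.trans hx (Eq.symm hy)) (Eq.trans hx' (Eq.symm hy')))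
  exact HasLogOn.of_fibers hf (isClosed_singleton.preimage hre) him
    (fun u => (hsub u).isPreconnected) fun u => HasLogOn.of_subsingleton (hsub u) fun z _ => h0 z

/-- For `v` in the open disk, `z - v` has no continuous logarithm on the unit circle. -/
theorem not_hasLogOn_circle {v : ℂ} (hv : ‖v‖ < 1) :
    ¬ HasLogOn (fun z : CDisk => (z : ℂ) - v) {z | ‖(z : ℂ)‖ = 1} := by
  intro h
  have h1 : HasLogOn (fun z : CDisk => (z : ℂ)) {z | ‖(z : ℂ)‖ = 1} := by
    refine h.of_div_mem_slitPlane (by fun_prop) (by fun_prop) fun z hz => ?_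
    have hz' : ‖(z : ℂ)‖ = 1 := hz
    have hz0 : (z : ℂ) ≠ 0 := norm_ne_zero_iff.1 (by rw [hz']; exact one_ne_zero)
    have h2 : 1 + -(v / z) ∈ slitPlane := mem_slitPlane_of_norm_lt_one (by simpa [hz'] using hv)
    have h3 : (z : ℂ) / (z - v) = (1 + -(v / z))⁻¹ := by
      rw [← sub_eq_add_neg, one_sub_div hz0, inv_div]
    rw [h3]
    have hpos := normSq_pos.2 (slitPlane_ne_zero h2)
    rcases h2 with h2 | h2
    · exact Or.inl (by rw [inv_re]; exact div_pos h2 hpos)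
    · exact Or.inr (by rw [inv_im]; exact div_ne_zero (neg_ne_zero.2 h2) hpos.ne')
  obtain ⟨Φ, hΦ, he⟩ := h1
  have hc : ContinuousOn (fun θ : ℝ => Φ (bdry θ)) univ :=
    hΦ.comp continuous_bdry.continuousOn fun θ _ => norm_bdry θ
  have := sub_eq_sub_of_exp_eq (Ψ := fun θ : ℝ => θ * I) isPreconnected_univ hc (by fun_prop)
    (fun θ _ => (he _ (norm_bdry θ)).trans (coe_bdry θ)) (mem_univ 0) (mem_univ (0 + 2 * Real.pi))
  rw [bdry_add_two_pi] at this
  simp at this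
  exact two_pi_I_ne_zero (sub_eq_self.1 this.symm)

/-- Existence of continuous logarithms of `z - w` on `F` is stable under perturbation of `w`. -/
theorem exists_log_perturb {F : Set CDisk} {w w' : CDisk} {Φ : CDisk → ℂ} (hΦ : ContinuousOn Φ F)
    (he : ∀ z ∈ F, exp (Φ z) = z - w) (hw : ∀ z ∈ F, dist w w' < dist z w) :
    ContinuousOn (fun z => Φ z + log (1 + ((w : ℂ) - w') / (z - w))) F ∧
      ∀ z ∈ F, exp (Φ z + log (1 + ((w : ℂ) - w') / (z - w))) = z - w' := by
  have h0 : ∀ z ∈ F, (z : ℂ) - w ≠ 0 := fun z hz => he z hz ▸ exp_ne_zero _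
  have hs : ∀ z ∈ F, 1 + ((w : ℂ) - w') / (z - w) ∈ slitPlane := by
    refine fun z hz => mem_slitPlane_of_norm_lt_one ?_
    rw [norm_div, div_lt_one (norm_pos_iff.2 (h0 z hz))]
    simpa [Subtype.dist_eq, dist_eq_norm] using hw z hz
  refine ⟨hΦ.add (ContinuousOn.clog ?_ hs), fun z hz => ?_⟩
  · exact continuousOn_const.add (continuousOn_const.div (by fun_prop) h0)
  · have h1 := h0 z hz
    rw [exp_add, he z hz, exp_log (slitPlane_ne_zero (hs z hz))]
    field_simp
    ring

variable {F W : Set CDisk}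

theorem exists_ball_lt_dist (hF : IsClosed F) {w : CDisk} (hw : w ∉ F) :
    ∃ δ > 0, ∀ w' ∈ Metric.ball w δ, w' ∉ F ∧
      (∀ z ∈ F, dist w w' < dist z w) ∧ ∀ z ∈ F, dist w' w < dist z w' := by
  obtain ⟨δ, hδ, hb⟩ := Metric.isOpen_iff.1 hF.isOpen_compl w hw
  have hb' : ∀ z ∈ F, δ ≤ dist z w := fun z hz => by
    by_contra! hlt
    exact hb hlt hz
  refine ⟨δ / 2, half_pos hδ, fun w' hw' => ?_⟩
  have h1 : dist w' w < δ / 2 := hw'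
  refine ⟨hb (Metric.mem_ball.2 (by linarith)), fun z hz => ?_, fun z hz => ?_⟩
  · rw [dist_comm w w']
    linarith [hb' z hz]
  · linarith [hb' z hz, dist_triangle z w' w]

/-- Existence of a continuous logarithm of `z - w` on `F` propagates along connected sets of
parameters `w` disjoint from `F`. -/
theorem hasLogOn_sub_of_isPreconnected (hF : IsClosed F) (hW : IsPreconnected W) (hWF : W ⊆ Fᶜ)
    {r w : CDisk} (hr : r ∈ W) (hw : w ∈ W)
    (hlog : HasLogOn (fun z : CDisk => (z : ℂ) - r) F) :
    HasLogOn (fun z : CDisk => (z : ℂ) - w) F := by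
  let L : Set CDisk := {w | w ∉ F ∧ HasLogOn (fun z : CDisk => (z : ℂ) - w) F}
  let N : Set CDisk := {w | w ∉ F ∧ ¬ HasLogOn (fun z : CDisk => (z : ℂ) - w) F}
  have hL : IsOpen L := by
    refine Metric.isOpen_iff.2 fun w hw => ?_
    obtain ⟨δ, hδ, hb⟩ := exists_ball_lt_dist hF hw.1
    refine ⟨δ, hδ, fun w' hw' => ⟨(hb w' hw').1, ?_⟩⟩
    obtain ⟨Φ, hΦ, he⟩ := hw.2
    exact ⟨_, exists_log_perturb hΦ he (hb w' hw').2.1⟩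
  have hN : IsOpen N := by
    refine Metric.isOpen_iff.2 fun w hw => ?_
    obtain ⟨δ, hδ, hb⟩ := exists_ball_lt_dist hF hw.1
    refine ⟨δ, hδ, fun w' hw' => ⟨(hb w' hw').1, fun hlog => hw.2 ?_⟩⟩
    obtain ⟨Φ, hΦ, he⟩ := hlog
    exact ⟨_, exists_log_perturb hΦ he (hb w' hw').2.2⟩
  have hLN : Disjoint L N := disjoint_left.2 fun w h1 h2 => h2.2 h1.2
  have hsub : W ⊆ L ∪ N := fun w hw => by
    by_cases h : HasLogOn (fun z : CDisk => (z : ℂ) - w) F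
    · exact Or.inl ⟨hWF hw, h⟩
    · exact Or.inr ⟨hWF hw, h⟩
  exact (hW.subset_left_of_subset_union hL hN hLN hsub ⟨r, hr, hWF hr, hlog⟩ hw).2

theorem re_one_sub_div_pos {r z : CDisk} (hr : ‖(r : ℂ)‖ = 1) (hz : z ≠ r) :
    0 < (1 - (z : ℂ) / r).re := by
  have hr0 : (r : ℂ) ≠ 0 := norm_ne_zero_iff.1 (by rw [hr]; exact one_ne_zero)
  have hn : ‖(z : ℂ) / r‖ ≤ 1 := by rw [norm_div, hr, div_one]; exact z.norm_le
  have hle : ((z : ℂ) / r).re ≤ 1 := (re_le_norm _).trans hn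
  rw [sub_re, one_re, sub_pos]
  refine lt_of_le_of_ne hle fun h => hz (Subtype.ext ?_)
  have him : ((z : ℂ) / r).im = 0 := by
    have h1 : normSq ((z : ℂ) / r) ≤ 1 := by
      rw [normSq_eq_norm_sq]
      exact pow_le_one₀ (norm_nonneg _) hn
    rw [normSq_apply, h] at h1
    nlinarith [mul_self_nonneg ((z : ℂ) / r).im]
  exact (div_eq_one_iff_eq hr0).1 (Complex.ext h him)

/-- The logarithm of `z - r` on the closed disk minus the boundary point `r`. -/
theorem exists_log_sub_boundary {r : CDisk} (hr : ‖(r : ℂ)‖ = 1) (hrF : r ∉ F) :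
    ContinuousOn (fun z : CDisk => log (-r) + log (1 - (z : ℂ) / r)) F ∧
      ∀ z ∈ F, exp (log (-r) + log (1 - (z : ℂ) / r)) = z - r := by
  have hr0 : (r : ℂ) ≠ 0 := norm_ne_zero_iff.1 (by rw [hr]; exact one_ne_zero)
  have hs : ∀ z ∈ F, 1 - (z : ℂ) / r ∈ slitPlane := fun z hz =>
    Or.inl (re_one_sub_div_pos hr fun h => hrF (h ▸ hz))
  refine ⟨continuousOn_const.add (ContinuousOn.clog (by fun_prop) hs), fun z hz => ?_⟩
  rw [exp_add, exp_log (neg_ne_zero.2 hr0), exp_log (slitPlane_ne_zero (hs z hz))]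
  field_simp
  ring

theorem arg_lt_arg_of_im_mul_conj_pos {a b : ℂ} (ha : 0 < a.re) (hb : 0 < b.re)
    (h : 0 < (a * (starRingEnd ℂ) b).im) : arg b < arg a := by
  have hsin : ‖a‖ * ‖b‖ * Real.sin (arg a - arg b) = (a * (starRingEnd ℂ) b).im := by
    rw [Real.sin_sub, mul_im, conj_re, conj_im]
    linear_combination (‖b‖ * Real.cos (arg b)) * norm_mul_sin_arg a +
      a.im * norm_mul_cos_arg b - (‖b‖ * Real.sin (arg b)) * norm_mul_cos_arg a -
      a.re * norm_mul_sin_arg b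
  have ha' := abs_arg_lt_pi_div_two_iff.2 (Or.inl ha)
  have hb' := abs_arg_lt_pi_div_two_iff.2 (Or.inl hb)
  rw [abs_lt] at ha' hb'
  by_contra! hle
  have hs : Real.sin (arg a - arg b) ≤ 0 :=
    Real.sin_nonpos_of_nonpos_of_neg_pi_le (by linarith) (by linarith)
  rw [← hsin] at h
  have : 0 ≤ ‖a‖ * ‖b‖ := by positivity
  nlinarith

theorem im_one_sub_bdry_div (α β θ : ℝ) :
    ((1 - (bdry α : ℂ) / bdry θ) * (starRingEnd ℂ) (1 - (bdry β : ℂ) / bdry θ)).im =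
      4 * Real.sin ((α - β) / 2) * Real.sin ((α - θ) / 2) * Real.sin ((β - θ) / 2) := by
  have hq : ∀ γ : ℝ, (bdry γ : ℂ) / bdry θ = exp ((γ - θ : ℝ) * I) := by
    intro γ
    rw [coe_bdry, coe_bdry, ← exp_sub]
    push_cast
    ring_nf
  have hα : α - θ = 2 * ((α - θ) / 2) := by ring
  have hβ : β - θ = 2 * ((β - θ) / 2) := by ring
  have hαβ : (α - β) / 2 = (α - θ) / 2 - (β - θ) / 2 := by ring
  rw [hq, hq, hαβ, mul_im, conj_re, conj_im, sub_re, sub_im, sub_re, sub_im, exp_ofReal_mul_I_re,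
    exp_ofReal_mul_I_re, exp_ofReal_mul_I_im, exp_ofReal_mul_I_im, hα, hβ,
    mul_div_cancel_left₀ _ two_ne_zero, mul_div_cancel_left₀ _ two_ne_zero]
  generalize (α - θ) / 2 = x
  generalize (β - θ) / 2 = y
  rw [Real.sin_sub, Real.sin_two_mul, Real.sin_two_mul, Real.cos_two_mul', Real.cos_two_mul',
    Real.cos_sq', Real.cos_sq']
  simp only [one_re, one_im]
  ring

/-- If `p, q` lie on the unit circle and `w` in the closed disk, then `p` and `q` are not seen from
`w` in the same direction. -/
theorem sub_ne_smul_sub {p q w : CDisk} (hp : ‖(p : ℂ)‖ = 1) (hq : ‖(q : ℂ)‖ = 1) (hpq : p ≠ q)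
    (hwp : w ≠ p) (hwq : w ≠ q) {k : ℝ} (hk : 0 < k) : (p : ℂ) - w ≠ k * (q - w) := by
  have key : ∀ {p q : CDisk} {k : ℝ}, ‖(p : ℂ)‖ = 1 → w ≠ q → 0 < k → k < 1 →
      (p : ℂ) - w ≠ k * (q - w) := by
    intro p q k hp hwq hk hk1 h
    have hlt : ‖(1 - k) • (w : ℂ) + k • (q : ℂ)‖ < 1 :=
      norm_combo_lt_of_ne w.norm_le q.norm_le (fun h => hwq (Subtype.ext h))
        (sub_pos.2 hk1) hk (by ring)
    have he : (1 - k) • (w : ℂ) + k • (q : ℂ) = p := by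
      simp only [real_smul]
      push_cast
      linear_combination -h
    rw [he, hp] at hlt
    exact lt_irrefl _ hlt
  rcases lt_trichotomy k 1 with h | rfl | h
  · exact key hp hwq hk h
  · intro he
    exact hpq (Subtype.ext (by simpa using he))
  · intro he
    refine key (p := q) (q := p) (k := k⁻¹) hq hwp (inv_pos.2 hk) (inv_lt_one_of_one_lt₀ h) ?_
    have hk0 : (k : ℂ) ≠ 0 := ofReal_ne_zero.2 hk.ne'
    rw [he]
    push_cast
    field_simp

/-- A closed connected set and a disjoint connected set in the closed disk cannot contain
interlaced pairs of boundary points. -/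
theorem not_interlaced (hF : IsClosed F) (hFc : IsPreconnected F) (hW : IsPreconnected W)
    (hWF : W ⊆ Fᶜ) {α β θ η : ℝ} (h1 : α < θ) (h2 : θ < β) (h3 : β < η)
    (h4 : η < α + 2 * Real.pi) (hα : bdry α ∈ F) (hβ : bdry β ∈ F) (hθ : bdry θ ∈ W)
    (hη : bdry η ∈ W) : False := by
  let p := bdry α
  let q := bdry β
  have hne : ∀ {x y}, x ∈ F → y ∈ W → x ≠ y := fun hx hy h => hWF hy (h ▸ hx)
  have hre : ∀ {γ δ}, bdry γ ∈ F → bdry δ ∈ W → 0 < (1 - (bdry γ : ℂ) / bdry δ).re :=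
    fun hγ hδ => re_one_sub_div_pos (norm_bdry _) (hne hγ hδ)
  have hαβ : Real.sin ((α - β) / 2) < 0 :=
    Real.sin_neg_of_neg_of_neg_pi_lt (by linarith) (by linarith)
  have hpq : p ≠ q := bdry_ne (h1.trans h2) (h3.trans h4)
  let A (σ : ℝ) : Set CDisk := {w | w ∉ F ∧ ∃ Φ : CDisk → ℂ, ContinuousOn Φ F ∧
    (∀ z ∈ F, exp (Φ z) = z - w) ∧ 0 < σ * (Φ p - Φ q).im}
  have hopen : ∀ σ, IsOpen (A σ) := by
    intro σ
    refine isOpen_iff_mem_nhds.2 fun w hw => ?_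
    obtain ⟨hwF, Φ, hΦ, he, hpos⟩ := hw
    obtain ⟨δ, hδ, hb⟩ := exists_ball_lt_dist hF hwF
    have hcont : ∀ x : CDisk, ContinuousAt
        (fun w' : CDisk => log (1 + ((w : ℂ) - w') / (x - w))) w := by
      intro x
      refine ContinuousAt.clog (by fun_prop) ?_
      simp [one_mem_slitPlane]
    have hlim : ContinuousAt (fun w' : CDisk => σ * ((Φ p + log (1 + ((w : ℂ) - w') / (p - w))) -
        (Φ q + log (1 + ((w : ℂ) - w') / (q - w)))).im) w :=
      continuousAt_const.mul (continuous_im.continuousAt.comp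
        ((continuousAt_const.add (hcont p)).sub (continuousAt_const.add (hcont q))))
    have hev := hlim.eventually (lt_mem_nhds (a := 0) (by simpa using hpos))
    filter_upwards [hev, Metric.ball_mem_nhds w hδ] with w' hw' hwb
    obtain ⟨c1, c2⟩ := exists_log_perturb hΦ he (hb w' hwb).2.1
    exact ⟨(hb w' hwb).1, _, c1, c2, hw'⟩
  have hlog : ∀ {δ}, bdry δ ∈ W → HasLogOn (fun z : CDisk => (z : ℂ) - bdry δ) F :=
    fun hδ => ⟨_, exists_log_sub_boundary (norm_bdry _) (hWF hδ)⟩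
  have hcover : W ⊆ A 1 ∪ A (-1) := by
    intro w hw
    obtain ⟨Φ, hΦ, he⟩ := hasLogOn_sub_of_isPreconnected hF hW hWF hθ hw (hlog hθ)
    rcases lt_trichotomy (Φ p - Φ q).im 0 with h | h | h
    · exact Or.inr ⟨hWF hw, Φ, hΦ, he, by linarith⟩
    · exfalso
      refine sub_ne_smul_sub (norm_bdry α) (norm_bdry β) hpq (hne hα hw).symm (hne hβ hw).symm
        (Real.exp_pos (Φ p - Φ q).re) ?_
      have hreal : (((Φ p - Φ q).re : ℝ) : ℂ) = Φ p - Φ q := Complex.ext (by simp) (by simp [h])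
      rw [← show exp (Φ p) = p - w from he _ hα, ← show exp (Φ q) = q - w from he _ hβ, ofReal_exp, hreal, ← exp_add]
      congr 1
      ring
    · exact Or.inl ⟨hWF hw, Φ, hΦ, he, by linarith⟩
  have hdisj : Disjoint (A 1) (A (-1)) := by
    refine disjoint_left.2 ?_
    rintro w ⟨-, Φ, hΦ, he, hpos⟩ ⟨-, Ψ, hΨ, he', hneg⟩
    have := sub_eq_sub_of_exp_eq hFc hΦ hΨ (fun x hx => (he x hx).trans (he' x hx).symm) hα hβ
    have h' : Φ p - Φ q = Ψ p - Ψ q := by linear_combination this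
    rw [h'] at hpos
    linarith
  have hA : ∀ {δ}, bdry δ ∈ W → ∀ σ, 0 < σ * (arg (1 - (p : ℂ) / bdry δ) -
      arg (1 - (q : ℂ) / bdry δ)) → bdry δ ∈ A σ := by
    intro δ hδ σ hσ
    obtain ⟨c1, c2⟩ := exists_log_sub_boundary (norm_bdry δ) (hWF hδ)
    refine ⟨hWF hδ, _, c1, c2, ?_⟩
    rwa [add_sub_add_left_eq_sub, sub_im, log_im, log_im]
  have hθA : bdry θ ∈ A 1 := by
    refine hA hθ 1 ?_
    rw [one_mul, sub_pos]
    refine arg_lt_arg_of_im_mul_conj_pos (hre hα hθ) (hre hβ hθ) ?_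
    rw [im_one_sub_bdry_div]
    have e3 : Real.sin ((α - θ) / 2) < 0 :=
      Real.sin_neg_of_neg_of_neg_pi_lt (by linarith) (by linarith)
    have e4 : 0 < Real.sin ((β - θ) / 2) :=
      Real.sin_pos_of_pos_of_lt_pi (by linarith) (by linarith)
    nlinarith [mul_pos (mul_pos_of_neg_of_neg hαβ e3) e4]
  have hηA : bdry η ∈ A (-1) := by
    refine hA hη (-1) ?_
    rw [neg_one_mul, neg_sub, sub_pos]
    refine arg_lt_arg_of_im_mul_conj_pos (hre hβ hη) (hre hα hη) ?_
    rw [im_one_sub_bdry_div, show (β - α) / 2 = -((α - β) / 2) by ring, Real.sin_neg]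
    have e3 : Real.sin ((α - η) / 2) < 0 :=
      Real.sin_neg_of_neg_of_neg_pi_lt (by linarith) (by linarith)
    have e4 : Real.sin ((β - η) / 2) < 0 :=
      Real.sin_neg_of_neg_of_neg_pi_lt (by linarith) (by linarith)
    nlinarith [mul_pos (mul_pos_of_neg_of_neg e3 e4) (neg_pos.2 hαβ)]
  exact disjoint_left.1 hdisj
    (hW.subset_left_of_subset_union (hopen 1) (hopen (-1)) hdisj hcover ⟨_, hθ, hθA⟩ hη) hηA

theorem isPreconnected_compl_singleton (y : CDisk) : IsPreconnected ({y}ᶜ : Set CDisk) := by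
  rcases y.norm_le.lt_or_eq with hy | hy
  · have hpos : ∀ z : ℂ, (0 : ℝ) < max 1 ‖z‖ := fun z => lt_max_of_lt_left one_pos
    have hball : ∀ z : ℂ, z / (max 1 ‖z‖ : ℝ) ∈ Metric.closedBall (0 : ℂ) 1 := by
      intro z
      rw [mem_closedBall_zero_iff, norm_div, norm_real, Real.norm_of_nonneg (hpos z).le,
        div_le_one (hpos z)]
      exact le_max_right _ _
    let P : ℂ → CDisk := fun z => ⟨z / (max 1 ‖z‖ : ℝ), hball z⟩
    have hP : Continuous P := by
      refine Continuous.subtype_mk (continuous_id.div (by fun_prop) fun z => ?_) _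
      exact ofReal_ne_zero.2 (hpos z).ne'
    have hrank : 1 < Module.rank ℝ ℂ := by simp
    have himg : P '' {(y : ℂ)}ᶜ = {y}ᶜ := by
      ext w
      constructor
      · rintro ⟨z, hz, rfl⟩ h
        have h' : z / (max 1 ‖z‖ : ℝ) = y := congrArg Subtype.val h
        rcases le_total ‖z‖ 1 with h1 | h1
        · rw [max_eq_left h1, ofReal_one, div_one] at h'
          exact hz h'
        · rw [max_eq_right h1] at h'
          rw [← h', norm_div, norm_real, norm_norm, div_self (by linarith)] at hy
          exact lt_irrefl _ hy
      · intro hw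
        refine ⟨w, fun h => hw (Subtype.ext h), Subtype.ext ?_⟩
        simp [P, max_eq_left w.norm_le]
    rw [← himg]
    exact (isConnected_compl_singleton_of_one_lt_rank hrank (y : ℂ)).isPreconnected.image _
      hP.continuousOn
  · have hy0 : (y : ℂ) ≠ 0 := norm_ne_zero_iff.1 (by rw [hy]; exact one_ne_zero)
    have hlin : IsLinearMap ℝ fun z : ℂ => (z / y).re :=
      ⟨fun a b => by rw [add_div, add_re], fun c a => by
        rw [real_smul, mul_div_assoc, re_ofReal_mul, smul_eq_mul]⟩
    have hset : ({y}ᶜ : Set CDisk) = (↑) ⁻¹' {z : ℂ | (z / y).re < 1} := by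
      ext z
      simp only [mem_compl_iff, mem_singleton_iff, mem_preimage, mem_ofPred_eq]
      constructor
      · intro hz
        have := re_one_sub_div_pos hy hz
        rwa [sub_re, one_re, sub_pos] at this
      · rintro h rfl
        simp [div_self hy0] at h
    rw [hset]
    exact isPreconnected_of_convex (convex_halfSpace_lt hlin 1)

/-- A circle around a boundary point `b` meets the closed disk in a graph over the direction
tangent to the boundary at `b`. -/
theorem eq_of_dist_eq_of_im_div_eq {b y y' : CDisk} (hb : ‖(b : ℂ)‖ = 1)
    (hd : dist y b = dist y' b) (him : ((y : ℂ) / b).im = ((y' : ℂ) / b).im) : y = y' := by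
  have hb0 : (b : ℂ) ≠ 0 := norm_ne_zero_iff.1 (by rw [hb]; exact one_ne_zero)
  have hle : ∀ z : CDisk, ((z : ℂ) / b).re ≤ 1 := fun z =>
    (re_le_norm _).trans (by rw [norm_div, hb, div_one]; exact z.norm_le)
  have hdist : ∀ z : CDisk,
      dist z b ^ 2 = (((z : ℂ) / b).re - 1) ^ 2 + ((z : ℂ) / b).im ^ 2 := by
    intro z
    have h1 : dist z b = ‖(z : ℂ) / b - 1‖ := by
      rw [div_sub_one hb0, norm_div, hb, div_one, Subtype.dist_eq, dist_eq_norm]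
    rw [h1, ← normSq_eq_norm_sq, normSq_apply, sub_re, sub_im, one_re, one_im]
    ring
  have h := hdist y
  rw [hd, hdist y', him] at h
  have hre : ((y : ℂ) / b).re = ((y' : ℂ) / b).re := by
    nlinarith [hle y, hle y', sq_nonneg (((y : ℂ) / b).re - ((y' : ℂ) / b).re)]
  exact Subtype.ext ((div_left_inj' hb0).1 (Complex.ext hre him))

/-- A closed connected subset of the closed disk with connected complement meets the boundary
circle in a connected set. -/
theorem isPreconnected_inter_circle {F : Set CDisk} (hF : IsClosed F) (hFc : IsPreconnected F)
    (hFc' : IsPreconnected Fᶜ) : IsPreconnected (F ∩ {z | ‖(z : ℂ)‖ = 1}) := by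
  refine isPreconnected_of_forall_pair ?_
  rintro p ⟨hp, hp1⟩ q ⟨hq, hq1⟩
  obtain ⟨α, -, rfl⟩ := exists_bdry_eq 0 hp1
  obtain ⟨β, ⟨hβ1, hβ2⟩, rfl⟩ := exists_bdry_eq α hq1
  have harc : ∀ a b : ℝ, IsPreconnected (bdry '' Icc a b) := fun a b =>
    isPreconnected_Icc.image _ continuous_bdry.continuousOn
  have hcirc : ∀ {a b : ℝ}, (∀ θ ∈ Icc a b, bdry θ ∈ F) →
      bdry '' Icc a b ⊆ F ∩ {z | ‖(z : ℂ)‖ = 1} := by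
    rintro a b h _ ⟨θ, hθ, rfl⟩
    exact ⟨h θ hθ, norm_bdry θ⟩
  by_cases h1 : ∀ θ ∈ Icc α β, bdry θ ∈ F
  · exact ⟨_, hcirc h1, ⟨α, ⟨le_rfl, hβ1⟩, rfl⟩, ⟨β, ⟨hβ1, le_rfl⟩, rfl⟩, harc _ _⟩
  by_cases h2 : ∀ θ ∈ Icc β (α + 2 * Real.pi), bdry θ ∈ F
  · exact ⟨_, hcirc h2, ⟨α + 2 * Real.pi, ⟨hβ2.le, le_rfl⟩, bdry_add_two_pi α⟩,
      ⟨β, ⟨le_rfl, hβ2.le⟩, rfl⟩, harc _ _⟩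
  push Not at h1 h2
  obtain ⟨θ, hθ, hθF⟩ := h1
  obtain ⟨η, hη, hηF⟩ := h2
  have hne : ∀ {a b}, bdry a ∈ F → bdry b ∉ F → a ≠ b := fun ha hb h => hb (h ▸ ha)
  exact (not_interlaced hF hFc hFc' Subset.rfl (hθ.1.lt_of_ne (hne hp hθF))
    (hθ.2.lt_of_ne (hne hq hθF).symm) (hη.1.lt_of_ne (hne hq hηF))
    (hη.2.lt_of_ne (hne ((bdry_add_two_pi α).symm ▸ hp) hηF).symm) hp hq hθF hηF).elim

section MonotoneMap

variable {h : CDisk → CDisk}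

theorem isPreconnected_preimage (hc : Continuous h) (hfib : ∀ b, IsConnected (h ⁻¹' {b}))
    {s : Set CDisk} (hs : IsPreconnected s) : IsPreconnected (h ⁻¹' s) :=
  hs.preimage_of_connected_fibers hc hc.isClosedMap hfib

theorem isPreconnected_compl_fiber (hc : Continuous h) (hfib : ∀ b, IsConnected (h ⁻¹' {b}))
    (b : CDisk) : IsPreconnected (h ⁻¹' {b})ᶜ := by
  rw [← preimage_compl]
  exact isPreconnected_preimage hc hfib (isPreconnected_compl_singleton b)

/-- Every boundary point is the image of a boundary point. -/
theorem exists_boundary_preimage (hc : Continuous h) (hfib : ∀ b, IsConnected (h ⁻¹' {b}))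
    {b : CDisk} (hb : ‖(b : ℂ)‖ = 1) : ∃ x : CDisk, ‖(x : ℂ)‖ = 1 ∧ h x = b := by
  by_contra! hcon
  have hScl : IsClosed {x : CDisk | ‖(x : ℂ)‖ = 1} := isClosed_eq (by fun_prop) continuous_const
  have hnhds : (h '' {x : CDisk | ‖(x : ℂ)‖ = 1})ᶜ ∈ 𝓝 b := by
    refine (hc.isClosedMap _ hScl).isOpen_compl.mem_nhds ?_
    rintro ⟨x, hx, hxb⟩
    exact hcon x hx hxb
  obtain ⟨r, hr, hball⟩ := Metric.nhds_basis_closedBall.mem_iff.1 hnhds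
  have hfar : ∀ x : CDisk, ‖(x : ℂ)‖ = 1 → r < dist (h x) b := by
    intro x hx
    by_contra! hle
    exact hball hle ⟨x, hx, rfl⟩
  obtain ⟨v, hv⟩ := (hfib b).nonempty
  replace hv : h v = b := hv
  have hv1 : ‖(v : ℂ)‖ < 1 := v.norm_le.lt_of_ne fun h1 => hcon v h1 hv
  have hdc : Continuous fun z => dist (h z) b := by fun_prop
  let K : Set CDisk := {z | dist (h z) b = r}
  have hK : IsClosed K := isClosed_eq hdc continuous_const
  have hsub : Continuous fun z : CDisk => (z : ℂ) - v := by fun_prop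
  have hp : Continuous fun z : CDisk => ((h z : ℂ) / b).im := by fun_prop
  have hfiber : ∀ t, K ∩ (fun z : CDisk => ((h z : ℂ) / b).im) ⁻¹' {t} = ∅ ∨
      ∃ y, dist y b = r ∧ K ∩ (fun z : CDisk => ((h z : ℂ) / b).im) ⁻¹' {t} = h ⁻¹' {y} := by
    intro t
    refine (eq_empty_or_nonempty _).imp_right ?_
    rintro ⟨x, hxK, hxt⟩
    refine ⟨h x, hxK, Subset.antisymm ?_ ?_⟩
    · rintro z ⟨hzK, hzt⟩
      exact eq_of_dist_eq_of_im_div_eq hb (Eq.trans hzK (Eq.symm hxK))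
        (Eq.trans hzt (Eq.symm hxt))
    · intro z hz
      have hz' : h z = h x := hz
      simp only [K, mem_inter_iff, mem_ofPred_eq, mem_preimage, hz']
      exact ⟨hxK, hxt⟩
  have hfiberLog : ∀ y, dist y b = r →
      HasLogOn (fun z : CDisk => (z : ℂ) - v) (h ⁻¹' {y}) := by
    intro y hy
    have h1 : bdry 0 ∉ h ⁻¹' {y} := by
      intro hmem
      have := hfar (bdry 0) (norm_bdry 0)
      rw [show h (bdry 0) = y from hmem, hy] at this
      exact lt_irrefl _ this
    have h2 : v ∉ h ⁻¹' {y} := by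
      intro hmem
      rw [← show h v = y from hmem, hv, dist_self] at hy
      exact hr.ne hy
    exact hasLogOn_sub_of_isPreconnected (isClosed_singleton.preimage hc)
      (isPreconnected_compl_fiber hc hfib y) Subset.rfl h1 h2
      ⟨_, exists_log_sub_boundary (norm_bdry 0) h1⟩
  have hlogK : HasLogOn (fun z : CDisk => (z : ℂ) - v) K := by
    refine HasLogOn.of_fibers hsub hK hp (fun t => ?_) fun t => ?_
    · rcases hfiber t with h0 | ⟨y, -, hy⟩
      · rw [h0]
        exact isPreconnected_empty
      · rw [hy]
        exact (hfib y).isPreconnected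
    · rcases hfiber t with h0 | ⟨y, hyr, hy⟩
      · rw [h0]
        exact HasLogOn.of_subsingleton subsingleton_empty (by simp)
      · rw [hy]
        exact hfiberLog y hyr
  obtain ⟨Φ, hΦ, he⟩ := hlogK
  obtain ⟨Ψ, hΨ⟩ := ContinuousMap.exists_restrict_eq hK ⟨_, hΦ.domRestrict⟩
  have hΨ' : ∀ x ∈ K, Ψ x = Φ x := fun x hx => DFunLike.congr_fun hΨ ⟨x, hx⟩
  let g : CDisk → ℂ := fun z => if r ≤ dist (h z) b then (z : ℂ) - v else exp (Ψ z)
  have hg : Continuous g := by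
    refine Continuous.if_le hsub (continuous_exp.comp Ψ.continuous) continuous_const hdc ?_
    intro z hz
    rw [hΨ' z hz.symm, he z hz.symm]
  have hg0 : ∀ z, g z ≠ 0 := by
    intro z
    by_cases hz : r ≤ dist (h z) b
    · rw [show g z = (z : ℂ) - v from if_pos hz, sub_ne_zero]
      intro hzv
      rw [show z = v from Subtype.ext hzv, hv, dist_self] at hz
      exact hz.not_gt hr
    · rw [show g z = exp (Ψ z) from if_neg hz]
      exact exp_ne_zero _
  obtain ⟨L, hL, hLe⟩ := hasLogOn_univ hg hg0
  refine not_hasLogOn_circle hv1 ⟨L, hL.mono (subset_univ _), fun z hz => ?_⟩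
  rw [hLe z (mem_univ z)]
  exact if_pos (hfar z hz).le

/-- The preimages on the circle of three boundary points cannot be ordered with a boundary point of
interior image. -/
theorem not_interior_image_of_lt (hc : Continuous h) (hfib : ∀ b, IsConnected (h ⁻¹' {b}))
    {α θ₁ θ₂ θ₃ : ℝ} (hα : ‖(h (bdry α) : ℂ)‖ < 1) (h1 : α < θ₁) (h12 : θ₁ < θ₂) (h23 : θ₂ < θ₃)
    (h3 : θ₃ < α + 2 * Real.pi) (hn1 : ‖(h (bdry θ₁) : ℂ)‖ = 1) (hn2 : ‖(h (bdry θ₂) : ℂ)‖ = 1)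
    (hn3 : ‖(h (bdry θ₃) : ℂ)‖ = 1) (hne1 : h (bdry θ₁) ≠ h (bdry θ₂))
    (hne3 : h (bdry θ₃) ≠ h (bdry θ₂)) : False := by
  obtain ⟨γ, -, hγ⟩ := exists_bdry_eq 0 hn2
  let W : Set CDisk := bdry '' Ioo γ (γ + 2 * Real.pi)
  let J : Set CDisk := (↑) ⁻¹' segment ℝ (h (bdry α) : ℂ) (h (bdry θ₂))
  have hW : IsPreconnected W := isPreconnected_Ioo.image _ continuous_bdry.continuousOn
  have hJ : IsPreconnected J := isPreconnected_of_convex (convex_segment _ _)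
  have hJcl : IsClosed J := by
    have hseg : IsClosed (segment ℝ (h (bdry α) : ℂ) (h (bdry θ₂))) := by
      rw [segment_eq_image]
      exact (isCompact_Icc.image (by fun_prop)).isClosed
    exact hseg.preimage continuous_subtype_val
  have hmemW : ∀ y : CDisk, ‖(y : ℂ)‖ = 1 → y ≠ h (bdry θ₂) → y ∈ W := by
    intro y hy hne
    obtain ⟨θ, ⟨hθ1, hθ2⟩, rfl⟩ := exists_bdry_eq γ hy
    refine ⟨θ, ⟨hθ1.lt_of_ne ?_, hθ2⟩, rfl⟩
    rintro rfl
    exact hne hγ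
  have hWJ : ∀ y ∈ W, y ∉ J := by
    rintro _ ⟨θ, ⟨hθ1, hθ2⟩, rfl⟩ ⟨a, b, ha, hb, hab, he⟩
    have hnorm : 1 ≤ a * ‖(h (bdry α) : ℂ)‖ + b := by
      calc (1 : ℝ) = ‖a • (h (bdry α) : ℂ) + b • (h (bdry θ₂) : ℂ)‖ := by rw [he, norm_bdry]
        _ ≤ ‖a • (h (bdry α) : ℂ)‖ + ‖b • (h (bdry θ₂) : ℂ)‖ := norm_add_le _ _
        _ = a * ‖(h (bdry α) : ℂ)‖ + b := by
          rw [norm_smul, norm_smul, hn2, Real.norm_of_nonneg ha, Real.norm_of_nonneg hb, mul_one]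
    have ha0 : a = 0 := by nlinarith
    have hb1 : b = 1 := by linarith
    rw [ha0, hb1, zero_smul, one_smul, zero_add] at he
    exact bdry_ne hθ1 hθ2 (hγ.trans (Subtype.ext he))
  exact not_interlaced (hJcl.preimage hc) (isPreconnected_preimage hc hfib hJ)
    (isPreconnected_preimage hc hfib hW) (fun x hx => hWJ _ hx) h1 h12 h23 h3
    (left_mem_segment ℝ _ _) (right_mem_segment ℝ _ _) (hmemW _ hn1 hne1) (hmemW _ hn3 hne3)

/-- Boundary points are mapped to boundary points. -/
theorem norm_image_eq_one (hc : Continuous h) (hfib : ∀ b, IsConnected (h ⁻¹' {b}))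
    {x : CDisk} (hx : ‖(x : ℂ)‖ = 1) : ‖(h x : ℂ)‖ = 1 := by
  by_contra hne
  obtain ⟨α, -, rfl⟩ := exists_bdry_eq 0 hx
  have hα : ‖(h (bdry α) : ℂ)‖ < 1 := (norm_le _).lt_of_ne hne
  have hpre : ∀ γ, ∃ θ, α < θ ∧ θ < α + 2 * Real.pi ∧ h (bdry θ) = bdry γ := by
    intro γ
    obtain ⟨t, ht, htγ⟩ := exists_boundary_preimage hc hfib (norm_bdry γ)
    obtain ⟨θ, ⟨hθ1, hθ2⟩, rfl⟩ := exists_bdry_eq α ht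
    refine ⟨θ, hθ1.lt_of_ne ?_, hθ2, htγ⟩
    rintro rfl
    exact hne (htγ ▸ norm_bdry γ)
  have d12 : bdry 0 ≠ bdry 1 := bdry_ne one_pos (by linarith [Real.pi_gt_three])
  have d23 : bdry 1 ≠ bdry 2 := bdry_ne one_lt_two (by linarith [Real.pi_gt_three])
  have d13 : bdry 0 ≠ bdry 2 := bdry_ne two_pos (by linarith [Real.pi_gt_three])
  obtain ⟨θ₁, a1, b1, e1⟩ := hpre 0
  obtain ⟨θ₂, a2, b2, e2⟩ := hpre 1
  obtain ⟨θ₃, a3, b3, e3⟩ := hpre 2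
  have n1 : ‖(h (bdry θ₁) : ℂ)‖ = 1 := e1 ▸ norm_bdry 0
  have n2 : ‖(h (bdry θ₂) : ℂ)‖ = 1 := e2 ▸ norm_bdry 1
  have n3 : ‖(h (bdry θ₃) : ℂ)‖ = 1 := e3 ▸ norm_bdry 2
  rw [← e1, ← e2] at d12
  rw [← e2, ← e3] at d23
  rw [← e1, ← e3] at d13
  have key := @not_interior_image_of_lt h hc hfib α
  have t12 : θ₁ ≠ θ₂ := fun h => d12 (by rw [h])
  have t23 : θ₂ ≠ θ₃ := fun h => d23 (by rw [h])
  have t13 : θ₁ ≠ θ₃ := fun h => d13 (by rw [h])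
  rcases t12.lt_or_gt with l12 | l12 <;> rcases t23.lt_or_gt with l23 | l23 <;>
    rcases t13.lt_or_gt with l13 | l13
  · exact key hα a1 l12 l23 b3 n1 n2 n3 d12 d23.symm
  · exact lt_asymm (l12.trans l23) l13
  · exact key hα a1 l13 l23 b2 n1 n3 n2 d13 d23
  · exact key hα a3 l13 l12 b2 n3 n1 n2 d13.symm d12.symm
  · exact key hα a2 l12 l13 b3 n2 n1 n3 d12.symm d13.symm
  · exact key hα a2 l23 l13 b1 n2 n3 n1 d23 d13
  · exact lt_asymm (l23.trans l12) l13
  · exact key hα a3 l23 l12 b1 n3 n2 n1 d23.symm d12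

end MonotoneMap

end CDisk

/-- A monotone self-map of the closed unit disk maps the boundary circle onto the
boundary circle, and its restriction to the circle is again monotone: it is a
continuous surjection of `S¹` onto `S¹` with connected fibers. -/
theorem monotone_disk_boundary_map
    (h : (Metric.closedBall (0 : EuclideanSpace ℝ (Fin 2)) 1) →
         (Metric.closedBall (0 : EuclideanSpace ℝ (Fin 2)) 1))
    (hcont : Continuous h) (hsurj : Function.Surjective h)
    (hfib : ∀ b, IsConnected (h ⁻¹' {b})) :
    h '' {x : Metric.closedBall (0 : EuclideanSpace ℝ (Fin 2)) 1 | ‖x.val‖ = 1}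
      = {y : Metric.closedBall (0 : EuclideanSpace ℝ (Fin 2)) 1 | ‖y.val‖ = 1} ∧
    ∀ b : Metric.closedBall (0 : EuclideanSpace ℝ (Fin 2)) 1, ‖b.val‖ = 1 →
      IsConnected ((h ⁻¹' {b}) ∩
        {x : Metric.closedBall (0 : EuclideanSpace ℝ (Fin 2)) 1 | ‖x.val‖ = 1}) := by
  let e : ℂ ≃ₗᵢ[ℝ] EuclideanSpace ℝ (Fin 2) := Complex.orthonormalBasisOneI.repr
  let E : CDisk ≃ₜ Metric.closedBall (0 : EuclideanSpace ℝ (Fin 2)) 1 :=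
    e.toHomeomorph.subtype fun z => by simp
  have hE : ∀ z, ‖(E z).val‖ = ‖(z : ℂ)‖ := fun z => e.norm_map z
  have hE' : ∀ x, ‖(E.symm x : ℂ)‖ = ‖x.val‖ := fun x => by rw [← hE, E.apply_symm_apply]
  let k : CDisk → CDisk := fun z => E.symm (h (E z))
  have hk : Continuous k := E.symm.continuous.comp (hcont.comp E.continuous)
  have hpre : ∀ b, k ⁻¹' {E.symm b} = E ⁻¹' (h ⁻¹' {b}) := fun b => by
    ext z
    simp [k]
  have hkfib : ∀ b, IsConnected (k ⁻¹' {b}) := fun b => by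
    rw [← E.symm_apply_apply b, hpre, E.isConnected_preimage]
    exact hfib _
  refine ⟨Subset.antisymm ?_ ?_, fun b hb => ⟨?_, ?_⟩⟩
  · rintro _ ⟨x, hx, rfl⟩
    have := CDisk.norm_image_eq_one hk hkfib (x := E.symm x) ((hE' x).trans hx)
    simpa [k, hE'] using this
  · intro y hy
    obtain ⟨z, hz, hzy⟩ := CDisk.exists_boundary_preimage hk hkfib ((hE' y).trans hy)
    exact ⟨E z, (hE z).trans hz, E.symm.injective hzy⟩
  · obtain ⟨z, hz, hzb⟩ := CDisk.exists_boundary_preimage hk hkfib ((hE' b).trans hb)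
    exact ⟨E z, E.symm.injective hzb, (hE z).trans hz⟩
  · have := CDisk.isPreconnected_inter_circle (isClosed_singleton.preimage hk)
      (hkfib (E.symm b)).isPreconnected (CDisk.isPreconnected_compl_fiber hk hkfib (E.symm b))
    have hset : k ⁻¹' {E.symm b} ∩ {z : CDisk | ‖(z : ℂ)‖ = 1} =
        E ⁻¹' (h ⁻¹' {b} ∩ {x | ‖x.val‖ = 1}) := by
      rw [hpre]
      ext z
      simp [hE]
    rwa [hset, E.isPreconnected_preimage] at this
end

section
/- Let S¹ denote the unit circle in ℝ² and D̄ the closed unit disk with open interior D. Every monotone map g : S¹ → S¹ admits an extension to a monotone map H : D̄ → D̄ of D̄ onto D̄ (so H(x) = g(x) for all x ∈ S¹) whose restriction to D is a homeomorphism of the open disk D onto itself. -/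
open Set Real

/-- A connected subset of the circle with at least two points has nonempty interior. -/
theorem Circle.interior_nonempty_of_isPreconnected {S : Set Circle} (hS : IsPreconnected S)
    (hnt : S.Nontrivial) : (interior S).Nonempty := by
  by_cases huniv : S = univ
  · simp [huniv]
  obtain ⟨p, hp⟩ := (ne_univ_iff_exists_notMem S).1 huniv
  set q : Circle → ℂ := fun z ↦ -((z / p : Circle) : ℂ) with hq
  have hqc : Continuous q := by fun_prop
  have hslit : ∀ z, z ≠ p → q z ∈ Complex.slitPlane := by
    intro z hz
    rw [Complex.mem_slitPlane_iff_arg]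
    refine ⟨fun harg ↦ hz ?_, neg_ne_zero.2 (Circle.coe_ne_zero _)⟩
    have hn : ‖q z‖ = 1 := by rw [hq, norm_neg, Circle.norm_coe]
    have h := Complex.norm_mul_exp_arg_mul_I (q z)
    rw [hn, harg, Complex.exp_pi_mul_I] at h
    have h2 : ((z / p : Circle) : ℂ) = 1 := by
      simp only [hq] at h
      simpa using h.symm
    exact div_eq_one.1 (Circle.coe_eq_one.1 h2)
  have hcont : ContinuousOn (fun z ↦ (q z).arg) {p}ᶜ := fun z hz ↦
    ((Complex.continuousAt_arg (hslit z hz)).comp hqc.continuousAt).continuousWithinAt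
  have hSp : S ⊆ {p}ᶜ := fun z hz h ↦ hp (h ▸ hz)
  have hinj : ∀ z w, (q z).arg = (q w).arg → z = w := by
    intro z w h
    have hz : ‖q z‖ = ‖q w‖ := by simp only [hq, norm_neg, Circle.norm_coe]
    have := Complex.ext_norm_arg hz h
    exact div_left_injective (Circle.ext (neg_injective this))
  have himg := (hS.image _ (hcont.mono hSp)).ordConnected
  obtain ⟨x, hx, y, hy, hxy⟩ : ∃ x ∈ S, ∃ y ∈ S, (q x).arg < (q y).arg := by
    obtain ⟨x, hx, y, hy, hxy⟩ := hnt
    rcases lt_or_gt_of_ne (fun h ↦ hxy (hinj x y h)) with h | h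
    exacts [⟨x, hx, y, hy, h⟩, ⟨y, hy, x, hx, h⟩]
  have hsub := himg.out (mem_image_of_mem _ hx) (mem_image_of_mem _ hy)
  obtain ⟨c, hc⟩ := exists_between hxy
  obtain ⟨z, hz, hzc⟩ := hsub ⟨hc.1.le, hc.2.le⟩
  refine ⟨z, mem_interior.2 ⟨{p}ᶜ ∩ (fun z ↦ (q z).arg) ⁻¹' Ioo (q x).arg (q y).arg, ?_,
    hcont.isOpen_inter_preimage isOpen_compl_singleton isOpen_Ioo, hSp hz, ?_⟩⟩
  · rintro w ⟨-, hw⟩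
    obtain ⟨w', hw', heq⟩ := hsub (Ioo_subset_Icc_self hw)
    exact hinj w' w heq ▸ hw'
  · simpa [hzc] using hc

/-- If all fibers of a circle map are connected, then those with at most one point are dense. -/
theorem Circle.exists_mem_Ioo_subsingleton_preimage {f : Circle → Circle}
    (hfib : ∀ b, IsConnected (f ⁻¹' {b})) {lo hi : ℝ} (h : lo < hi) :
    ∃ v ∈ Ioo lo hi, (f ⁻¹' {Circle.exp v}).Subsingleton := by
  by_contra! hcon
  set hi' := min hi (lo + 2 * π)
  have hlt : lo < hi' := lt_min h (by linarith [pi_pos])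
  have hdisj : (Ioo lo hi').PairwiseDisjoint fun v ↦ f ⁻¹' {Circle.exp v} := by
    intro v hv w hw hvw
    refine Disjoint.preimage _ (disjoint_singleton.2 fun heq ↦ hvw ?_)
    exact Circle.exp_injOn_Ico (a := lo) (b := hi') (by linarith [min_le_right hi (lo + 2 * π)])
      (Ioo_subset_Ico_self hv) (Ioo_subset_Ico_self hw) heq
  have hcount := hdisj.countable_of_nonempty_interior fun v hv ↦
    Circle.interior_nonempty_of_isPreconnected (hfib _).isPreconnected
      (hcon v ⟨hv.1, hv.2.trans_le (min_le_left _ _)⟩)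
  exact (Cardinal.Real.Ioo_countable_iff.1 hcount).not_gt hlt

/-- A continuous circle map lifts to the line and has a degree. -/
theorem Circle.exists_lift {f : Circle → Circle} (hf : Continuous f) :
    ∃ F : ℝ → ℝ, Continuous F ∧ (∀ t, f (Circle.exp t) = Circle.exp (F t)) ∧
      ∃ d : ℤ, ∀ t, F (t + 2 * π) = F t + d * (2 * π) := by
  obtain ⟨e₀, he⟩ := Circle.exp_surjective (f (Circle.exp 0))
  obtain ⟨F, ⟨-, hF⟩, -⟩ := Circle.isCoveringMap_exp.existsUnique_continuousMap_lifts
    (⟨fun t : ℝ ↦ f (Circle.exp t), by fun_prop⟩ : C(ℝ, Circle)) 0 e₀ he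
  have hF' : ∀ t, f (Circle.exp t) = Circle.exp (F t) := fun t ↦ (congrFun hF t).symm
  refine ⟨F, F.continuous, hF', ?_⟩
  obtain ⟨d, hd⟩ : ∃ d : ℤ, F (0 + 2 * π) = F 0 + d * (2 * π) := by
    rw [← Circle.exp_eq_exp, ← hF', ← hF', Circle.exp_add_two_pi]
  refine ⟨d, fun t ↦ ?_⟩
  have := Circle.isCoveringMap_exp.eq_of_comp_eq (g₁ := fun t : ℝ ↦ F (t + 2 * π))
    (g₂ := fun t : ℝ ↦ F t + d * (2 * π)) (by fun_prop) (by fun_prop) ?_ 0 hd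
  · exact congrFun this t
  · ext1 t
    simp only [Function.comp_apply]
    rw [← hF', Circle.exp_add_two_pi, hF', Circle.exp_eq_exp]
    exact ⟨-d, by push_cast; ring⟩

/-- The values `v` of `F` that are attained, modulo `2π`, only along one coset of `2πℤ` are dense. -/
def DenselyInjectiveModTwoPi (F : ℝ → ℝ) : Prop :=
  ∀ lo hi : ℝ, lo < hi → ∃ v ∈ Ioo lo hi, ∀ s t : ℝ, ∀ k : ℤ,
    F s = v → F t = v + k * (2 * π) → ∃ m : ℤ, t = s + m * (2 * π)

theorem DenselyInjectiveModTwoPi.neg {F : ℝ → ℝ} (hF : DenselyInjectiveModTwoPi F) :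
    DenselyInjectiveModTwoPi (-F) := by
  intro lo hi h
  obtain ⟨v, hv, H⟩ := hF (-hi) (-lo) (neg_lt_neg h)
  refine ⟨-v, ⟨by linarith [hv.2], by linarith [hv.1]⟩, fun s t k hs ht ↦ H s t (-k) ?_ ?_⟩
  · exact neg_injective hs
  · simp only [Pi.neg_apply] at ht
    push_cast
    linarith

/-- Around a point where `F` turns back, some value is attained at two points that are congruent
modulo `2π`. -/
theorem DenselyInjectiveModTwoPi.exists_eq_of_turn {F : ℝ → ℝ} (hF : DenselyInjectiveModTwoPi F)
    (hc : Continuous F) {a b c : ℝ} (hab : a ≤ b) (hbc : b ≤ c)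
    (h : F a < F b ∧ F c < F b ∨ F b < F a ∧ F b < F c) :
    ∃ s ∈ Ioo a c, ∃ t ∈ Ioo a c, s < t ∧ F s = F t ∧ ∃ m : ℤ, t = s + m * (2 * π) := by
  wlog hh : F a < F b ∧ F c < F b generalizing F
  · obtain ⟨s, hs, t, ht, hst, heq, hm⟩ := this hF.neg hc.neg
      (by simpa only [Pi.neg_apply, neg_lt_neg_iff] using h.symm)
      (by simpa only [Pi.neg_apply, neg_lt_neg_iff] using h.resolve_left hh)
    exact ⟨s, hs, t, ht, hst, neg_injective heq, hm⟩
  obtain ⟨v, hv, H⟩ := hF _ _ (max_lt hh.1 hh.2)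
  obtain ⟨s, hs, rfl⟩ := intermediate_value_Ioo hab hc.continuousOn
    ⟨(le_max_left _ _).trans_lt hv.1, hv.2⟩
  obtain ⟨t, ht, hts⟩ := intermediate_value_Ioo' hbc hc.continuousOn
    ⟨(le_max_right _ _).trans_lt hv.1, hv.2⟩
  exact ⟨s, ⟨hs.1, hs.2.trans_le hbc⟩, t, ⟨hab.trans_lt ht.1, ht.2⟩, hs.2.trans ht.1, hts.symm,
    H s t 0 rfl (by simp [hts])⟩

theorem map_add_int_mul_two_pi {F : ℝ → ℝ} {d : ℤ}
    (hd : ∀ t, F (t + 2 * π) = F t + d * (2 * π)) (m : ℤ) (t : ℝ) :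
    F (t + m * (2 * π)) = F t + m * d * (2 * π) := by
  have hper : Function.Periodic (fun t ↦ F t - d * t) (2 * π) := fun t ↦ by
    simp only [hd]; ring
  have := hper.int_mul m t
  linear_combination this

theorem DenselyInjectiveModTwoPi.degree_ne_zero {F : ℝ → ℝ} (hF : DenselyInjectiveModTwoPi F)
    (hc : Continuous F) {d : ℤ} (hd : ∀ t, F (t + 2 * π) = F t + d * (2 * π))
    (hnc : ∃ a b, F a ≠ F b) : d ≠ 0 := by
  rintro rfl
  have hper : Function.Periodic F (2 * π) := fun t ↦ by simpa using hd t
  obtain ⟨a, b, hab⟩ := hnc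
  obtain ⟨b', hb', hbb'⟩ := hper.exists_mem_Ico two_pi_pos b a
  rw [hbb'] at hab
  have h := hper a
  obtain ⟨s, hs, t, ht, hst, -, m, rfl⟩ := hF.exists_eq_of_turn hc hb'.1 hb'.2.le (by
    rw [h]
    rcases lt_or_gt_of_ne hab with h | h
    exacts [.inl ⟨h, h⟩, .inr ⟨h, h⟩])
  have h0 : (0 : ℝ) < m := by
    by_contra! hm
    nlinarith [pi_pos]
  have h1 : (1 : ℝ) ≤ m := by exact_mod_cast h0
  nlinarith [pi_pos, hs.1, ht.2]

theorem DenselyInjectiveModTwoPi.monotone_or_antitone {F : ℝ → ℝ}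
    (hF : DenselyInjectiveModTwoPi F) (hc : Continuous F) {d : ℤ}
    (hd : ∀ t, F (t + 2 * π) = F t + d * (2 * π)) (hd0 : d ≠ 0) :
    Monotone F ∨ Antitone F := by
  by_contra! hcon
  obtain ⟨a, b, c, hab, hbc, h⟩ := not_monotone_not_antitone_iff_exists_le_le.1 hcon
  obtain ⟨s, -, t, -, hst, heq, m, rfl⟩ := hF.exists_eq_of_turn hc hab hbc h
  rw [map_add_int_mul_two_pi hd] at heq
  have h0 : (m : ℝ) * d * (2 * π) = 0 := by linarith
  have hm : m ≠ 0 := by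
    rintro rfl
    simp at hst
  simp [hm, hd0, pi_ne_zero] at h0

theorem DenselyInjectiveModTwoPi.degree_eq_one {F : ℝ → ℝ} (hF : DenselyInjectiveModTwoPi F)
    (hc : Continuous F) {d : ℤ} (hd : ∀ t, F (t + 2 * π) = F t + d * (2 * π)) (hd0 : d ≠ 0)
    (hmono : Monotone F) : d = 1 := by
  have hpi := pi_pos
  have hdF := hd 0
  have hnonneg : (0 : ℝ) ≤ d := by
    have := hmono (show (0 : ℝ) ≤ 0 + 2 * π by linarith)
    by_contra! h
    nlinarith
  have hnonneg' : 0 ≤ d := by exact_mod_cast hnonneg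
  by_contra hd1
  have h2 : (2 : ℝ) ≤ d := by exact_mod_cast (by omega : 2 ≤ d)
  obtain ⟨v, hv, H⟩ := hF (F 0) (F 0 + 2 * π) (by linarith)
  have himg := intermediate_value_Ioo (show (0 : ℝ) ≤ 0 + 2 * π by linarith) hc.continuousOn
  obtain ⟨s, hs, hsv⟩ := himg (show v ∈ _ from ⟨hv.1, by rw [hdF]; nlinarith [hv.2]⟩)
  obtain ⟨t, ht, htv⟩ := himg (show v + 2 * π ∈ _ from
    ⟨by linarith [hv.1], by rw [hdF]; nlinarith [hv.2]⟩)
  obtain ⟨m, rfl⟩ := H s t 1 hsv (by simpa using htv)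
  have hm1 : m < 1 := by
    have : (m : ℝ) < 1 := by
      by_contra! h
      nlinarith [hs.1, ht.2]
    exact_mod_cast this
  have hm2 : 0 < m := by
    have : (0 : ℝ) < m := by
      by_contra! h
      have := hmono (show s + m * (2 * π) ≤ s by nlinarith)
      linarith
    exact_mod_cast this
  omega

/-- The circle map with lift `G` extends to the plane by interpolating, in polar coordinates, between
the identity at the origin and `G` on the unit circle. -/
theorem exists_polar_extension {G : ℝ → ℝ} (hc : Continuous G) (hmono : Monotone G)
    (hG : ∀ t, G (t + 2 * π) = G t + 2 * π) :
    ∃ H : ℂ → ℂ, Continuous H ∧ (∀ z, ‖H z‖ = ‖z‖) ∧ InjOn H (Metric.ball 0 1) ∧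
      SurjOn H (Metric.closedBall 0 1) (Metric.closedBall 0 1) ∧
      ∀ t : ℝ, H (Circle.exp t) = Circle.exp (G t) := by
  have hper : Function.Periodic (fun t ↦ G t - t) (2 * π) := fun t ↦ by simp only [hG]; ring
  set P : Real.Angle → ℝ := hper.lift
  have hPc : Continuous P := continuous_quot_lift _ (by fun_prop)
  set H : ℂ → ℂ := fun z ↦ z * Circle.exp (‖z‖ * P z.arg) with hH
  have hnorm : ∀ z, ‖H z‖ = ‖z‖ := fun z ↦ by
    rw [hH, norm_mul, Circle.norm_coe, mul_one]
  set Φ : ℝ → ℝ → ℝ := fun r t ↦ (1 - r) * t + r * G t with hΦ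
  have hpolar : ∀ r t : ℝ, 0 ≤ r → H (r * Circle.exp t) = r * Circle.exp (Φ r t) := by
    intro r t hr
    rcases hr.eq_or_lt with rfl | hr
    · simp [hH]
    have hnr : ‖(r * Circle.exp t : ℂ)‖ = r := by simp [abs_of_pos hr]
    have harg : (((r * Circle.exp t : ℂ).arg : ℝ) : Real.Angle) = t := by
      rw [Complex.arg_real_mul _ hr, Circle.coe_exp, Complex.arg_exp_mul_I, Real.Angle.coe_toIocMod]
    have hPt : P (t : Real.Angle) = G t - t := hper.lift_coe t
    simp only [hH, hnr, harg, hPt]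
    rw [mul_assoc, ← Circle.coe_mul, ← Circle.exp_add]
    congr 3
    simp only [hΦ]
    ring
  have hdecomp : ∀ z : ℂ, ∃ t : ℝ, z = ‖z‖ * Circle.exp t := fun z ↦
    ⟨z.arg, by simp [Complex.norm_mul_exp_arg_mul_I]⟩
  have hΦper : ∀ r t, ∀ m : ℤ, Φ r (t + m * (2 * π)) = Φ r t + m * (2 * π) := by
    intro r t m
    have := hper.int_mul m t
    simp only [hΦ] at this ⊢
    linear_combination r * this
  refine ⟨H, ?_, hnorm, ?_, ?_, ?_⟩
  · refine continuous_iff_continuousAt.2 fun z ↦ ?_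
    by_cases hz : z = 0
    · subst hz
      have h0 : H 0 = 0 := by simp [hH]
      rw [ContinuousAt, h0, tendsto_zero_iff_norm_tendsto_zero]
      simp only [hnorm]
      simpa using (continuous_norm (E := ℂ)).tendsto 0
    · have h1 := hPc.continuousAt.comp (Complex.continuousAt_arg_coe_angle hz)
      have h2 : ContinuousAt (fun z : ℂ ↦ ‖z‖ * P z.arg) z := continuous_norm.continuousAt.mul h1
      exact continuousAt_id.mul
        ((continuous_subtype_val.comp Circle.exp.continuous).continuousAt.comp h2)
  · intro z hz w hw hzw
    have hr : ‖z‖ = ‖w‖ := by rw [← hnorm z, hzw, hnorm]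
    rw [mem_ball_zero_iff] at hz
    obtain ⟨s, hs⟩ := hdecomp z
    obtain ⟨t, ht⟩ := hdecomp w
    rw [← hr] at ht
    generalize hrr : ‖z‖ = r at *
    have hr0 : 0 ≤ r := hrr ▸ norm_nonneg z
    rcases hr0.eq_or_lt with h0 | hr0'
    · rw [hs, ht, ← h0]; simp
    rw [hs, ht, hpolar r s hr0, hpolar r t hr0] at hzw
    have hexp := mul_left_cancel₀ (Complex.ofReal_ne_zero.2 hr0'.ne') hzw
    obtain ⟨m, hm⟩ := Circle.exp_eq_exp.1 (Circle.ext hexp)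
    rw [← hΦper] at hm
    have hstrict : StrictMono (Φ r) :=
      (strictMono_id.const_mul (sub_pos.2 hz)).add_monotone (hmono.const_mul hr0)
    rw [hs, ht, Circle.exp_eq_exp.2 ⟨m, hstrict.injective hm⟩]
  · intro w hw
    rw [mem_closedBall_zero_iff] at hw
    obtain ⟨t, ht⟩ := hdecomp w
    set r := ‖w‖
    have hr0 : 0 ≤ r := norm_nonneg w
    have hΦc : Continuous (Φ r) := by fun_prop
    obtain ⟨s, hs⟩ : ∃ s, Φ r s = t := by
      obtain ⟨n, hn⟩ := exists_nat_gt (|t - Φ r 0| / (2 * π))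
      rw [div_lt_iff₀ two_pi_pos] at hn
      have h1 := hΦper r 0 n
      have h2 := hΦper r 0 (-n)
      have h3 := abs_lt.1 hn
      push_cast at h1 h2
      exact mem_range_of_exists_le_of_exists_ge hΦc ⟨_, h2.trans_le (by linarith)⟩
        ⟨_, le_of_le_of_eq (by linarith) h1.symm⟩
    refine ⟨r * Circle.exp s, ?_, ?_⟩
    · simpa [abs_of_nonneg hr0] using hw
    · rw [hpolar r s hr0, hs, ← ht]
  · intro t
    simpa [hΦ] using hpolar 1 t zero_le_one

/-- A norm-preserving self-map of `E` that is injective on the open ball and restricts to `g` on the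
sphere is a monotone extension of `g` and a homeomorphism of the open ball. -/
theorem exists_extension_of_norm_preserving {E : Type*} [NormedAddCommGroup E] [ProperSpace E]
    {g : Metric.sphere (0 : E) 1 → Metric.sphere (0 : E) 1}
    (hgfib : ∀ b, IsConnected (g ⁻¹' {b})) {K : E → E} (hc : Continuous K)
    (hnorm : ∀ z, ‖K z‖ = ‖z‖) (hinj : InjOn K (Metric.ball 0 1))
    (hsurj : SurjOn K (Metric.closedBall 0 1) (Metric.closedBall 0 1))
    (hKg : ∀ x : Metric.sphere (0 : E) 1, K x = g x) :
    ∃ H : Metric.closedBall (0 : E) 1 → Metric.closedBall (0 : E) 1,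
      Continuous H ∧ Function.Surjective H ∧ (∀ b, IsConnected (H ⁻¹' {b})) ∧
      (∀ x : Metric.sphere (0 : E) 1,
        (H ⟨x.val, Metric.sphere_subset_closedBall x.property⟩).val = (g x).val) ∧
      ∃ e : Metric.ball (0 : E) 1 ≃ₜ Metric.ball (0 : E) 1,
        ∀ x : Metric.ball (0 : E) 1,
          (e x).val = (H ⟨x.val, Metric.ball_subset_closedBall x.property⟩).val := by
  have hmaps : MapsTo K (Metric.closedBall 0 1) (Metric.closedBall 0 1) := fun z hz ↦ by
    simpa [hnorm] using hz
  have hmaps' : MapsTo K (Metric.ball 0 1) (Metric.ball 0 1) := fun z hz ↦ by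
    simpa [hnorm] using hz
  have hsurj' : SurjOn K (Metric.ball 0 1) (Metric.ball 0 1) := fun w hw ↦ by
    obtain ⟨z, -, rfl⟩ := hsurj (Metric.ball_subset_closedBall hw)
    exact ⟨z, by simpa [hnorm] using hw, rfl⟩
  have hKproper : IsClosedMap (hmaps'.restrict K) := by
    have hclosed : IsClosedMap K := by
      refine (isProperMap_iff_tendsto_cocompact.2 ⟨hc, ?_⟩).isClosedMap
      rw [← Metric.cobounded_eq_cocompact, ← tendsto_norm_atTop_iff_cobounded]
      simpa only [hnorm] using tendsto_norm_cobounded_atTop (E := E)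
    have hpre : K ⁻¹' Metric.ball 0 1 = Metric.ball 0 1 := by ext z; simp [hnorm]
    have key : ∀ (s t : Set E) (h : MapsTo K s t), K ⁻¹' t = s → IsClosedMap (h.restrict K) := by
      rintro s t h rfl
      exact hclosed.restrictPreimage t
    exact key _ _ _ hpre
  have hcr : Continuous (hmaps.restrict K) := hc.restrict hmaps
  have hhomeo : IsHomeomorph (hmaps'.restrict K) :=
    isHomeomorph_iff_continuous_isClosedMap_bijective.2
      ⟨hc.restrict hmaps', hKproper, hmaps'.restrict_inj.2 hinj,
        (MapsTo.restrict_surjective_iff hmaps').2 hsurj'⟩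
  refine ⟨hmaps.restrict K, hcr, (MapsTo.restrict_surjective_iff hmaps).2 hsurj, fun b ↦ ?_,
    hKg, hhomeo.homeomorph, fun x ↦ rfl⟩
  obtain ⟨a, ha, hab⟩ := hsurj b.2
  rcases (mem_closedBall_zero_iff.1 b.2).lt_or_eq with hb | hb
  · convert isConnected_singleton (x := (⟨a, ha⟩ : Metric.closedBall (0 : E) 1))
    ext z
    simp only [mem_preimage, mem_singleton_iff, Subtype.ext_iff, MapsTo.val_restrict_apply]
    constructor
    · intro h
      refine hinj ?_ ?_ (h.trans hab.symm)
      · rwa [mem_ball_zero_iff, ← hnorm, h]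
      · rwa [mem_ball_zero_iff, ← hnorm, hab]
    · rintro h
      rw [h, hab]
  · convert (hgfib ⟨b, by simpa using hb⟩).image
      (fun x ↦ (⟨x.1, Metric.sphere_subset_closedBall x.2⟩ : Metric.closedBall (0 : E) 1))
      (by fun_prop)
    ext z
    simp only [mem_preimage, mem_singleton_iff, Subtype.ext_iff, MapsTo.val_restrict_apply,
      mem_image]
    constructor
    · intro h
      have hz : z.1 ∈ Metric.sphere (0 : E) 1 := by rw [mem_sphere_zero_iff_norm, ← hnorm, h, hb]
      exact ⟨⟨z, hz⟩, (hKg ⟨z, hz⟩).symm.trans h, rfl⟩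
    · rintro ⟨x, hx, hxz⟩
      rw [← hxz, hKg, hx]

/-- A lift of a circle map with connected fibers is densely injective modulo `2π`. -/
theorem Circle.denselyInjectiveModTwoPi_lift {f : Circle → Circle}
    (hfib : ∀ b, IsConnected (f ⁻¹' {b})) {F : ℝ → ℝ}
    (hF : ∀ t, f (Circle.exp t) = Circle.exp (F t)) : DenselyInjectiveModTwoPi F := by
  intro lo hi h
  obtain ⟨v, hv, hsub⟩ := Circle.exists_mem_Ioo_subsingleton_preimage hfib h
  refine ⟨v, hv, fun s t k hs ht ↦ Circle.exp_eq_exp.1 (hsub ?_ ?_)⟩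
  · rw [mem_preimage, hF, mem_singleton_iff, Circle.exp_eq_exp]
    exact ⟨k, ht⟩
  · rw [mem_preimage, hF, mem_singleton_iff, hs]

/-- A continuous self-map of the circle with connected fibers extends to a norm-preserving
self-map of the plane that is injective on the open disk. -/
theorem Circle.exists_norm_preserving_extension {f : Circle → Circle} (hf : Continuous f)
    (hfib : ∀ b, IsConnected (f ⁻¹' {b})) :
    ∃ H : ℂ → ℂ, Continuous H ∧ (∀ z, ‖H z‖ = ‖z‖) ∧ InjOn H (Metric.ball 0 1) ∧
      SurjOn H (Metric.closedBall 0 1) (Metric.closedBall 0 1) ∧ ∀ z : Circle, H z = f z := by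
  obtain ⟨F, hc, hF, d, hd⟩ := Circle.exists_lift hf
  have hdense := Circle.denselyInjectiveModTwoPi_lift hfib hF
  have hnc : ∃ a b, F a ≠ F b := by
    obtain ⟨x, hx⟩ := (hfib 1).nonempty
    obtain ⟨y, hy⟩ := (hfib (Circle.exp π)).nonempty
    obtain ⟨a, rfl⟩ := Circle.exp_surjective x
    obtain ⟨b, rfl⟩ := Circle.exp_surjective y
    refine ⟨a, b, fun h ↦ ?_⟩
    have hab : Circle.exp π = 1 := by
      rw [mem_preimage, mem_singleton_iff, hF] at hx hy
      rw [← hy, ← h, hx]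
    have := congrArg (fun z : Circle ↦ (z : ℂ)) hab
    norm_num [Circle.coe_exp, Complex.exp_pi_mul_I] at this
  have hd0 := hdense.degree_ne_zero hc hd hnc
  rcases hdense.monotone_or_antitone hc hd hd0 with hmono | hanti
  · obtain rfl := hdense.degree_eq_one hc hd hd0 hmono
    obtain ⟨H, h1, h2, h3, h4, h5⟩ := exists_polar_extension hc hmono (by simpa using hd)
    refine ⟨H, h1, h2, h3, h4, fun z ↦ ?_⟩
    obtain ⟨t, rfl⟩ := Circle.exp_surjective z
    rw [h5, hF]
  · have hd' : ∀ t, (-F) (t + 2 * π) = (-F) t + (-d : ℤ) * (2 * π) := fun t ↦ by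
      simp only [Pi.neg_apply, hd]
      push_cast
      ring
    have hd1 := hdense.neg.degree_eq_one hc.neg hd' (neg_ne_zero.2 hd0) hanti.neg
    rw [hd1] at hd'
    obtain ⟨H, h1, h2, h3, h4, h5⟩ := exists_polar_extension hc.neg hanti.neg (by simpa using hd')
    refine ⟨fun z ↦ starRingEnd ℂ (H z), by fun_prop, fun z ↦ by rw [RCLike.norm_conj, h2],
      fun z hz w hw h ↦ h3 hz hw ((starRingEnd ℂ).injective h), fun w hw ↦ ?_, fun z ↦ ?_⟩
    · obtain ⟨z, hz, hzw⟩ := h4 (show starRingEnd ℂ w ∈ Metric.closedBall 0 1 by simpa using hw)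
      exact ⟨z, hz, by simp [hzw]⟩
    · obtain ⟨t, rfl⟩ := Circle.exp_surjective z
      change starRingEnd ℂ (H (Circle.exp t)) = _
      rw [h5, hF, ← Circle.coe_inv_eq_conj, ← Circle.exp_neg, Pi.neg_apply, neg_neg]


/-- Homeomorphic extension of a monotone boundary map, specialized to the disk:
every monotone self-map of the unit circle extends to a monotone self-map of the
closed unit disk whose restriction to the open disk is a homeomorphism of the
open disk onto itself. -/
theorem monotone_circle_map_extends_to_disk
    (g : (Metric.sphere (0 : EuclideanSpace ℝ (Fin 2)) 1) →
         (Metric.sphere (0 : EuclideanSpace ℝ (Fin 2)) 1))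
    (hgcont : Continuous g) (hgsurj : Function.Surjective g)
    (hgfib : ∀ b, IsConnected (g ⁻¹' {b})) :
    ∃ H : (Metric.closedBall (0 : EuclideanSpace ℝ (Fin 2)) 1) →
          (Metric.closedBall (0 : EuclideanSpace ℝ (Fin 2)) 1),
      Continuous H ∧ Function.Surjective H ∧ (∀ b, IsConnected (H ⁻¹' {b})) ∧
      (∀ x : Metric.sphere (0 : EuclideanSpace ℝ (Fin 2)) 1,
        (H ⟨x.val, Metric.sphere_subset_closedBall x.property⟩).val = (g x).val) ∧
      ∃ e : (Metric.ball (0 : EuclideanSpace ℝ (Fin 2)) 1) ≃ₜ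
            (Metric.ball (0 : EuclideanSpace ℝ (Fin 2)) 1),
        ∀ x : Metric.ball (0 : EuclideanSpace ℝ (Fin 2)) 1,
          ((e x).val : EuclideanSpace ℝ (Fin 2)) =
            (H ⟨x.val, Metric.ball_subset_closedBall x.property⟩).val := by
  let L : EuclideanSpace ℝ (Fin 2) ≃ₗᵢ[ℝ] ℂ := Complex.orthonormalBasisOneI.repr.symm
  let φ : Metric.sphere (0 : EuclideanSpace ℝ (Fin 2)) 1 ≃ₜ Circle :=
    L.toHomeomorph.subtype fun x ↦ by
      change _ ↔ L x ∈ Metric.sphere (0 : ℂ) 1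
      simp
  have hφ : ∀ x, (φ x : ℂ) = L x := fun x ↦ rfl
  obtain ⟨H, h1, h2, h3, h4, h5⟩ := Circle.exists_norm_preserving_extension (f := φ ∘ g ∘ φ.symm)
    (by fun_prop) fun b ↦ by
      have : φ ∘ g ∘ φ.symm ⁻¹' {b} = φ '' (g ⁻¹' {φ.symm b}) := by
        ext z
        simp [φ.image_eq_preimage_symm, φ.eq_symm_apply]
      rw [this]
      exact (hgfib _).image _ φ.continuous.continuousOn
  refine exists_extension_of_norm_preserving hgfib (K := fun x ↦ L.symm (H (L x)))
    (by fun_prop) (fun z ↦ by simp [h2]) ?_ ?_ ?_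
  · intro x hx y hy hxy
    exact L.injective (h3 (by simpa using hx) (by simpa using hy) (L.symm.injective hxy))
  · intro y hy
    obtain ⟨z, hz, hzy⟩ := h4 (show L y ∈ Metric.closedBall 0 1 by simpa using hy)
    exact ⟨L.symm z, by simpa using hz, by simp [hzy]⟩
  · intro x
    rw [← hφ, h5]
    simp [hφ]
end

section
/- Let h : S² → S² be a monotone map of the unit 2-sphere onto itself, and let Q ⊆ S² be a Jordan domain. Then the preimage h⁻¹(Q) is a nonempty open connected subset of S² which is simply connected as a topological space. -/
open Set Topology unitInterval

section TreeOfSimplyConnectedSets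

variable {X : Type*} [TopologicalSpace X]

namespace IsSimplyConnected

variable {D D' : Set X} {x y z : X}

/-- The homotopy class of the paths from `x` to `y` that stay in a simply connected set. -/
noncomputable def pathClass (hD : IsSimplyConnected D) (hx : x ∈ D) (hy : y ∈ D) :
    Path.Homotopic.Quotient x y :=
  .mk (hD.isPathConnected.joinedIn x hx y hy).somePath

theorem homotopic_of_forall_mem (hD : IsSimplyConnected D) (p q : Path x y)
    (hp : ∀ t, p t ∈ D) (hq : ∀ t, q t ∈ D) : p.Homotopic q := by
  have := hD.simplyConnectedSpace
  have hx : x ∈ D := by simpa using hp 0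
  have hy : y ∈ D := by simpa using hp 1
  let lift (r : Path x y) (hr : ∀ t, r t ∈ D) : Path (⟨x, hx⟩ : D) ⟨y, hy⟩ :=
    { toFun := fun t ↦ ⟨r t, hr t⟩
      source' := by simp
      target' := by simp }
  exact (SimplyConnectedSpace.paths_homotopic (lift p hp) (lift q hq)).map
    ⟨Subtype.val, continuous_subtype_val⟩

theorem mk_eq_pathClass (hD : IsSimplyConnected D) (p : Path x y) (hp : ∀ t, p t ∈ D)
    (hx : x ∈ D) (hy : y ∈ D) : Path.Homotopic.Quotient.mk p = hD.pathClass hx hy :=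
  Path.Homotopic.Quotient.eq.2 <|
    hD.homotopic_of_forall_mem _ _ hp (JoinedIn.somePath_mem _)

theorem pathClass_self (hD : IsSimplyConnected D) (hx : x ∈ D) :
    hD.pathClass hx hx = .refl x :=
  (hD.mk_eq_pathClass (Path.refl x) (by simpa using hx) hx hx).symm

theorem pathClass_trans (hD : IsSimplyConnected D) (hx : x ∈ D) (hy : y ∈ D) (hz : z ∈ D) :
    (hD.pathClass hx hy).trans (hD.pathClass hy hz) = hD.pathClass hx hz := by
  refine hD.mk_eq_pathClass (Path.trans _ _) (fun t ↦ ?_) hx hz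
  have := mem_range_self (f := Path.trans (hD.isPathConnected.joinedIn x hx y hy).somePath
    (hD.isPathConnected.joinedIn y hy z hz).somePath) t
  rw [Path.trans_range] at this
  rcases this with ⟨s, hs⟩ | ⟨s, hs⟩ <;> rw [← hs] <;> exact JoinedIn.somePath_mem _ _

theorem pathClass_eq_of_isPathConnected_inter (hD : IsSimplyConnected D)
    (hD' : IsSimplyConnected D') (h : IsPathConnected (D ∩ D'))
    (hx : x ∈ D) (hy : y ∈ D) (hx' : x ∈ D') (hy' : y ∈ D') :
    hD.pathClass hx hy = hD'.pathClass hx' hy' := by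
  have hj := h.joinedIn x ⟨hx, hx'⟩ y ⟨hy, hy'⟩
  rw [← hD.mk_eq_pathClass hj.somePath (fun t ↦ (hj.somePath_mem t).1),
    hD'.mk_eq_pathClass hj.somePath (fun t ↦ (hj.somePath_mem t).2)]

/-- The homotopy class of the paths from `x ∈ D` to `z ∈ D'` that pass from `D` to `D'` inside
`D ∩ D'`. -/
noncomputable def crossClass (hD : IsSimplyConnected D) (hD' : IsSimplyConnected D')
    (h : (D ∩ D').Nonempty) (hx : x ∈ D) (hz : z ∈ D') : Path.Homotopic.Quotient x z :=
  (hD.pathClass hx h.some_mem.1).trans (hD'.pathClass h.some_mem.2 hz)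

theorem crossClass_eq (hD : IsSimplyConnected D) (hD' : IsSimplyConnected D')
    (hc : IsPathConnected (D ∩ D')) (h : (D ∩ D').Nonempty) (hx : x ∈ D) (hz : z ∈ D')
    (hy : y ∈ D ∩ D') : hD.crossClass hD' h hx hz =
      (hD.pathClass hx hy.1).trans (hD'.pathClass hy.2 hz) := by
  rw [crossClass, ← hD.pathClass_trans hx h.some_mem.1 hy.1,
    hD.pathClass_eq_of_isPathConnected_inter hD' hc h.some_mem.1 hy.1 h.some_mem.2 hy.2,
    Path.Homotopic.Quotient.trans_assoc, pathClass_trans]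

end IsSimplyConnected

section Nerve

variable {V : Type*} {G : SimpleGraph V}

/-- The composition of homotopy classes along a walk of a graph. -/
noncomputable def SimpleGraph.Walk.homotopyClass {b : V → X}
    (g : ∀ {i j : V}, G.Adj i j → Path.Homotopic.Quotient (b i) (b j)) :
    ∀ {i j : V}, G.Walk i j → Path.Homotopic.Quotient (b i) (b j)
  | _, _, .nil => .refl _
  | _, _, .cons h p => (g h).trans (p.homotopyClass g)

theorem SimpleGraph.Walk.homotopyClass_concat {b : V → X}
    (g : ∀ {i j : V}, G.Adj i j → Path.Homotopic.Quotient (b i) (b j)) {i j k : V}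
    (p : G.Walk i j) (h : G.Adj j k) :
    (p.concat h).homotopyClass g = (p.homotopyClass g).trans (g h) := by
  induction p with
  | nil => simp [SimpleGraph.Walk.concat, homotopyClass]
  | cons h' p ih => rw [concat_cons, homotopyClass, ih, homotopyClass,
      Path.Homotopic.Quotient.trans_assoc]

theorem SimpleGraph.IsAcyclic.homotopyClass_eq_of_isPath (hG : G.IsAcyclic) {b : V → X}
    (g : ∀ {i j : V}, G.Adj i j → Path.Homotopic.Quotient (b i) (b j))
    (hg : ∀ {i j : V} (h : G.Adj i j), (g h).trans (g h.symm) = .refl _) {i j : V}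
    (p q : G.Walk i j) (hq : q.IsPath) : p.homotopyClass g = q.homotopyClass g := by
  classical
  induction p with
  | nil =>
    rw [(SimpleGraph.Walk.isPath_iff_nil.1 hq).eq_nil]
  | @cons u v w h p ih =>
    have hb := p.bypass_isPath
    rw [SimpleGraph.Walk.homotopyClass, ih p.bypass hb]
    by_cases hu : u ∈ p.bypass.support
    · have key : p.bypass = .cons h.symm q := by
        have h1 : (SimpleGraph.Walk.cons h.symm (p.bypass.dropUntil u hu)).IsPath := by
          rw [SimpleGraph.Walk.cons_isPath_iff]
          refine ⟨hb.dropUntil hu, fun hv ↦ ?_⟩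
          have h2 : (p.bypass.takeUntil u hu).append (p.bypass.dropUntil u hu) = p.bypass :=
            p.bypass.take_spec hu
          have h3 := hb
          rw [← h2, SimpleGraph.Walk.isPath_def, SimpleGraph.Walk.support_append,
            List.nodup_append] at h3
          have h4 : v ∈ (p.bypass.dropUntil u hu).support.tail := by
            rw [← SimpleGraph.Walk.cons_tail_support] at hv
            exact (List.mem_cons.1 hv).resolve_left h.ne'
          exact h3.2.2 v (SimpleGraph.Walk.start_mem_support _) v h4 rfl
        have h5 := congrArg Subtype.val ((hG.subsingleton_path _ _).elim ⟨_, hb⟩ ⟨_, h1⟩)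
        have h6 := congrArg Subtype.val
          ((hG.subsingleton_path _ _).elim ⟨q, hq⟩ ⟨_, hb.dropUntil hu⟩)
        simp only at h5 h6
        rw [h5, h6]
      rw [key, SimpleGraph.Walk.homotopyClass, ← Path.Homotopic.Quotient.trans_assoc, hg,
        Path.Homotopic.Quotient.refl_trans]
    · have h1 : (SimpleGraph.Walk.cons h p.bypass).IsPath :=
        (SimpleGraph.Walk.cons_isPath_iff _ _).2 ⟨hb, hu⟩
      have h2 := congrArg Subtype.val ((hG.subsingleton_path _ _).elim ⟨q, hq⟩ ⟨_, h1⟩)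
      simp only at h2
      rw [h2, SimpleGraph.Walk.homotopyClass]

/-- A loop covered by simply connected sets whose nerve is a forest is null-homotopic. -/
theorem Path.homotopic_refl_of_isAcyclic_nerve (hG : G.IsAcyclic) {D : V → Set X}
    (hadj : ∀ i j, i ≠ j → (D i ∩ D j).Nonempty → G.Adj i j)
    (hadj' : ∀ i j, G.Adj i j → (D i ∩ D j).Nonempty)
    (hD : ∀ i, IsSimplyConnected (D i))
    (hDD : ∀ i j, (D i ∩ D j).Nonempty → IsPathConnected (D i ∩ D j))
    {x : X} (α : Path x x) (hα : ∀ t, ∃ i, α t ∈ D i)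
    (hN : ∀ t, ∃ N ∈ 𝓝 (α t), IsSimplyConnected N ∧
      ∀ i, (D i ∩ N).Nonempty → α t ∈ D i ∧ IsPathConnected (D i ∩ N)) :
    α.Homotopic (Path.refl x) := by
  choose b hb using fun i ↦ (hD i).nonempty
  let g : ∀ {i j : V}, G.Adj i j → Path.Homotopic.Quotient (b i) (b j) := fun {i j} h ↦
    (hD i).crossClass (hD j) (hadj' i j h) (hb i) (hb j)
  have g_eq {i j : V} (h : G.Adj i j) {z : X} (hz : z ∈ D i ∩ D j) :
      g h = ((hD i).pathClass (hb i) hz.1).trans ((hD j).pathClass hz.2 (hb j)) :=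
    (hD i).crossClass_eq (hD j) (hDD i j ⟨z, hz⟩) _ _ _ hz
  have hg {i j : V} (h : G.Adj i j) : (g h).trans (g h.symm) = .refl _ := by
    obtain ⟨z, hz⟩ := hadj' i j h
    rw [g_eq h hz, g_eq h.symm hz.symm, Path.Homotopic.Quotient.trans_assoc,
      ← Path.Homotopic.Quotient.trans_assoc ((hD j).pathClass hz.2 (hb j)),
      (hD j).pathClass_trans, (hD j).pathClass_self, Path.Homotopic.Quotient.refl_trans,
      (hD i).pathClass_trans, (hD i).pathClass_self]
  obtain ⟨i₀, hi₀⟩ := hα 0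
  let P (i : V) (t : I) : Prop := ∃ (hi : α t ∈ D i) (w : G.Walk i₀ i),
    Path.Homotopic.Quotient.mk (α.subpath 0 t) =
      ((hD i₀).pathClass hi₀ (hb i₀)).trans
        ((w.homotopyClass g).trans ((hD i).pathClass (hb i) hi))
  have change_set {i j : V} {t : I} (hj : α t ∈ D j) (h : P i t) : P j t := by
    obtain ⟨hi, w, hw⟩ := h
    rcases eq_or_ne i j with rfl | hij
    · exact ⟨hi, w, hw⟩
    · have hadj : G.Adj i j := hadj i j hij ⟨_, hi, hj⟩
      refine ⟨hj, w.concat hadj, ?_⟩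
      rw [hw, SimpleGraph.Walk.homotopyClass_concat, g_eq hadj ⟨hi, hj⟩,
        Path.Homotopic.Quotient.trans_assoc (w.homotopyClass g),
        Path.Homotopic.Quotient.trans_assoc ((hD i).pathClass _ _), (hD j).pathClass_trans,
        (hD j).pathClass_self, Path.Homotopic.Quotient.trans_refl]
  have change_time {i : V} {s t : I} {N : Set X} (hNs : IsSimplyConnected N)
      (hst : ∀ r ∈ uIcc s t, α r ∈ N) (hc : IsPathConnected (D i ∩ N)) (ht : α t ∈ D i)
      (h : P i s) : P i t := by
    obtain ⟨hi, w, hw⟩ := h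
    refine ⟨ht, w, ?_⟩
    have h1 : Path.Homotopic.Quotient.mk (α.subpath 0 t) =
        (Path.Homotopic.Quotient.mk (α.subpath 0 s)).trans (.mk (α.subpath s t)) := by
      rw [← Path.Homotopic.Quotient.mk_trans]
      exact Path.Homotopic.Quotient.eq.2 ⟨(Path.Homotopy.subpathTransSubpath α 0 s t).symm⟩
    have hsN := hst s left_mem_uIcc
    have htN := hst t right_mem_uIcc
    have h2 : Path.Homotopic.Quotient.mk (α.subpath s t) = (hD i).pathClass hi ht := by
      rw [(hD i).pathClass_eq_of_isPathConnected_inter hNs hc hi ht hsN htN]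
      refine hNs.mk_eq_pathClass _ (fun r ↦ ?_) _ _
      have := mem_range_self (f := α.subpath s t) r
      rw [Path.range_subpath] at this
      obtain ⟨r', hr', h⟩ := this
      exact h ▸ hst r' hr'
    rw [h1, h2, hw, Path.Homotopic.Quotient.trans_assoc, Path.Homotopic.Quotient.trans_assoc,
      (hD i).pathClass_trans]
  have hiff : ∀ s t : I, (∃ i, P i s) ↔ (∃ i, P i t) := by
    refine fun s t ↦ PreconnectedSpace.induction₂' (fun s t : I ↦ (∃ i, P i s) ↔ (∃ i, P i t))
      (fun t ↦ ?_) ⟨fun _ _ _ h h' ↦ h.trans h'⟩ s t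
    obtain ⟨N, hNt, hNs, hND⟩ := hN t
    have hT : α ⁻¹' N ∈ 𝓝 t := α.continuous.continuousAt hNt
    obtain ⟨T, hTn, hTc, hTs⟩ : ∃ T ∈ 𝓝 t, T.OrdConnected ∧ T ⊆ α ⁻¹' N := by
      obtain ⟨b, c, -, hbc, hsub⟩ := exists_Icc_mem_subset_of_mem_nhds hT
      exact ⟨_, hbc, ordConnected_Icc, hsub⟩
    have htT := mem_of_mem_nhds hTn
    filter_upwards [hTn] with s hs
    suffices h : (∃ i, P i t) ↔ (∃ i, P i s) from ⟨h, h.symm⟩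
    obtain ⟨j, hj⟩ := hα s
    obtain ⟨htj, hc⟩ := hND j ⟨_, hj, hTs hs⟩
    constructor
    · rintro ⟨i, hi⟩
      exact ⟨j, change_time hNs (fun r hr ↦ hTs (hTc.uIcc_subset htT hs hr)) hc hj
        (change_set htj hi)⟩
    · rintro ⟨i, hi⟩
      exact ⟨j, change_time hNs (fun r hr ↦ hTs (hTc.uIcc_subset hs htT hr)) hc htj
        (change_set hj hi)⟩
  have h0 : P i₀ 0 := by
    refine ⟨hi₀, .nil, ?_⟩
    rw [Path.subpath_self, SimpleGraph.Walk.homotopyClass, Path.Homotopic.Quotient.refl_trans,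
      (hD i₀).pathClass_trans, (hD i₀).pathClass_self, Path.Homotopic.Quotient.mk_refl]
  obtain ⟨i, hi⟩ := (hiff 0 1).1 ⟨i₀, h0⟩
  obtain ⟨h1, w, hw⟩ := change_set (j := i₀) (by simpa using hi₀) hi
  rw [hG.homotopyClass_eq_of_isPath g hg w .nil .nil, SimpleGraph.Walk.homotopyClass,
    Path.Homotopic.Quotient.refl_trans, (hD i₀).pathClass_trans,
    ← (hD i₀).mk_eq_pathClass ((Path.refl x).cast α.source α.target)
      (fun t ↦ by simpa using hi₀), Path.subpath_zero_one,
    Path.Homotopic.Quotient.eq] at hw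
  exact hw.pathCast α.source.symm α.target.symm

end Nerve

end TreeOfSimplyConnectedSets

section Crosscut

/-- Two points of a connected set `K` are joined by a continuous logarithm of
`z ↦ (z - P) / (z - Q)` on any compact set disjoint from `K`. -/
theorem IsPreconnected.exists_continuousOn_exp_eq_div {K C : Set ℂ} (hK : IsPreconnected K)
    (hC : IsCompact C) (hKC : Disjoint K C) {P Q : ℂ} (hP : P ∈ K) (hQ : Q ∈ K) :
    ∃ L : ℂ → ℂ, ContinuousOn L C ∧ ∀ z ∈ C, Complex.exp (L z) = (z - P) / (z - Q) := by
  have hne {P z : ℂ} (hP : P ∈ K) (hz : z ∈ C) : z - P ≠ 0 :=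
    sub_ne_zero.2 fun h ↦ hKC.notMem_of_mem_left hP (h ▸ hz)
  refine hK.induction₂ (fun P Q ↦ ∃ L : ℂ → ℂ, ContinuousOn L C ∧
    ∀ z ∈ C, Complex.exp (L z) = (z - P) / (z - Q)) ?_ ?_ ?_ hP hQ
  · intro P hP
    have hopen : Cᶜ ∈ 𝓝 P :=
      hC.isClosed.isOpen_compl.mem_nhds (hKC.notMem_of_mem_left hP)
    obtain ⟨ε, hε, hball⟩ := Metric.mem_nhds_iff.1 hopen
    filter_upwards [self_mem_nhdsWithin,
      mem_nhdsWithin_of_mem_nhds (Metric.ball_mem_nhds P hε)] with Q hQ hPQ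
    have hslit : ∀ z ∈ C, (z - Q) / (z - P) ∈ Complex.slitPlane := by
      intro z hz
      refine Complex.ball_one_subset_slitPlane ?_
      have h1 : (z - Q) / (z - P) - 1 = (P - Q) / (z - P) := by
        field_simp [hne hP hz]
        ring
      rw [mem_ball_iff_norm, h1, norm_div, div_lt_one (norm_pos_iff.2 (hne hP hz))]
      have h2 : ε ≤ ‖z - P‖ := by
        by_contra! h
        exact hball (mem_ball_iff_norm.2 h) hz
      refine lt_of_lt_of_le ?_ h2
      rwa [Metric.mem_ball, dist_comm, dist_eq_norm] at hPQ
    refine ⟨fun z ↦ -Complex.log ((z - Q) / (z - P)), ?_, fun z hz ↦ ?_⟩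
    · refine (ContinuousOn.clog ?_ hslit).neg
      exact (continuousOn_id.sub continuousOn_const).div
        (continuousOn_id.sub continuousOn_const) fun z hz ↦ hne hP hz
    · rw [Complex.exp_neg, Complex.exp_log (div_ne_zero (hne hQ hz) (hne hP hz)), inv_div]
  · rintro P Q R hP hQ hR ⟨L, hL, hL'⟩ ⟨M, hM, hM'⟩
    refine ⟨fun z ↦ L z + M z, hL.add hM, fun z hz ↦ ?_⟩
    rw [Complex.exp_add, hL' z hz, hM' z hz, div_mul_div_cancel₀ (hne hQ hz)]
  · rintro P Q hP hQ ⟨L, hL, hL'⟩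
    refine ⟨fun z ↦ -L z, hL.neg, fun z hz ↦ ?_⟩
    rw [Complex.exp_neg, hL' z hz, inv_div]

/-- Two continuous logarithms of the same function on a preconnected set differ by a constant. -/
theorem IsPreconnected.sub_eq_sub_of_exp_eq {s : Set ℂ} (hs : IsPreconnected s) {L M : ℂ → ℂ}
    (hL : ContinuousOn L s) (hM : ContinuousOn M s)
    (h : ∃ c : ℂ, ∀ z ∈ s, Complex.exp (L z) = c * Complex.exp (M z)) {a b : ℂ} (ha : a ∈ s)
    (hb : b ∈ s) : L a - M a = L b - M b := by
  obtain ⟨c, hc⟩ := h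
  have hexp : ∀ z ∈ s, Complex.exp (L z - M z) = c := fun z hz ↦ by
    rw [Complex.exp_sub, hc z hz, mul_div_cancel_right₀ _ (Complex.exp_ne_zero _)]
  have hcont : ContinuousOn (fun z ↦ (L z - M z - (L a - M a)) / (2 * Real.pi * Complex.I)) s :=
    ((hL.sub hM).sub continuousOn_const).div_const _
  have hmaps : MapsTo (fun z ↦ (L z - M z - (L a - M a)) / (2 * Real.pi * Complex.I)) s
      (range ((↑) : ℤ → ℂ)) := by
    intro z hz
    obtain ⟨n, hn⟩ := Complex.exp_eq_exp_iff_exists_int.1 ((hexp z hz).trans (hexp a ha).symm)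
    refine ⟨n, ?_⟩
    have := Complex.two_pi_I_ne_zero
    simp only
    rw [hn]
    field_simp
    ring
  have hdisc : IsDiscrete (range ((↑) : ℤ → ℂ)) := by
    rw [← image_univ]
    refine IsDiscrete.univ.image ?_
    simpa [Function.comp_def] using Complex.isUniformEmbedding_ofReal.isInducing.comp
      Int.isClosedEmbedding_coe_real.isInducing
  have := hs.constant_of_mapsTo hdisc hcont hmaps ha hb
  simp only [sub_self, zero_div] at this
  have h2 := (div_eq_zero_iff.1 this.symm).resolve_right Complex.two_pi_I_ne_zero
  exact (sub_eq_zero.1 h2).symm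

/-- The two sides of a horizontal segment with both endpoints in a connected set `K` cannot be
joined in the complement of `K` and of the segment. -/
theorem IsPreconnected.not_joinedIn_of_segment {K : Set ℂ} (hK : IsPreconnected K)
    {p q x y y₁ y₂ : ℝ} (hp : (⟨p, y⟩ : ℂ) ∈ K) (hq : (⟨q, y⟩ : ℂ) ∈ K) (hpx : p < x)
    (hxq : x < q) (h₁ : y₁ < y) (h₂ : y < y₂) (hv : ∀ t ∈ Icc y₁ y₂, (⟨x, t⟩ : ℂ) ∉ K) :
    ¬ JoinedIn {z | z ∉ K ∧ ¬ (z.im = y ∧ z.re ∈ Icc p q)} ⟨x, y₁⟩ ⟨x, y₂⟩ := by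
  intro hj
  set a : ℂ := ⟨x, y₁⟩
  set b : ℂ := ⟨x, y₂⟩
  set P : ℂ := ⟨p, y⟩ with hPdef
  set Q : ℂ := ⟨q, y⟩ with hQdef
  let R := range hj.somePath
  let T := (fun t : ℝ ↦ (⟨x, t⟩ : ℂ)) '' Icc y₁ y₂
  have hTcont : Continuous fun t : ℝ ↦ (⟨x, t⟩ : ℂ) := by
    have : (fun t : ℝ ↦ (⟨x, t⟩ : ℂ)) = fun t : ℝ ↦ (x : ℂ) + t * Complex.I := by
      ext t; simp [Complex.ext_iff]
    rw [this]; fun_prop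
  have hR : IsCompact R := isCompact_range hj.somePath.continuous
  have hT : IsCompact T := isCompact_Icc.image hTcont
  have hRc : IsPreconnected R := isPreconnected_range hj.somePath.continuous
  have hTc : IsPreconnected T := isPreconnected_Icc.image _ hTcont.continuousOn
  have hRK : ∀ z ∈ R, z ∉ K ∧ ¬ (z.im = y ∧ z.re ∈ Icc p q) := by
    rintro _ ⟨t, rfl⟩
    exact hj.somePath_mem t
  have hTK : ∀ z ∈ T, z ∉ K := by
    rintro _ ⟨t, ht, rfl⟩
    exact hv t ht
  have hKC : Disjoint K (R ∪ T) := by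
    rw [Set.disjoint_right]
    rintro z (hz | hz)
    exacts [(hRK z hz).1, hTK z hz]
  obtain ⟨L, hLc, hL⟩ := hK.exists_continuousOn_exp_eq_div (hR.union hT) hKC hp hq
  have hneP {z : ℂ} (hz : z ∈ R ∪ T) : z - P ≠ 0 :=
    sub_ne_zero.2 fun h ↦ hKC.notMem_of_mem_left hp (h ▸ hz)
  have hneQ {z : ℂ} (hz : z ∈ R ∪ T) : z - Q ≠ 0 :=
    sub_ne_zero.2 fun h ↦ hKC.notMem_of_mem_left hq (h ▸ hz)
  let f : ℂ → ℂ := fun z ↦ (z - P) / (z - Q)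
  have hf0 {z : ℂ} (hz : z ∈ R ∪ T) : f z ≠ 0 := div_ne_zero (hneP hz) (hneQ hz)
  have hf : ContinuousOn f (R ∪ T) :=
    (continuousOn_id.sub continuousOn_const).div
      (continuousOn_id.sub continuousOn_const) fun z hz ↦ hneQ hz
  have him (z : ℂ) : (f z).im = (p - q) * (z.im - y) / Complex.normSq (z - Q) := by
    simp only [f, Complex.div_im, Complex.sub_re, Complex.sub_im, hPdef, hQdef]
    ring
  have hre (z : ℂ) : (f z).re =
      ((z.re - p) * (z.re - q) + (z.im - y) ^ 2) / Complex.normSq (z - Q) := by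
    simp only [f, Complex.div_re, Complex.sub_re, Complex.sub_im, hPdef, hQdef]
    ring
  have hpq : p - q < 0 := by linarith
  have hnQ {z : ℂ} (hz : z ∈ R ∪ T) : 0 < Complex.normSq (z - Q) :=
    Complex.normSq_pos.2 (hneQ hz)
  have hsR : ∀ z ∈ R, f z ∈ Complex.slitPlane := by
    intro z hz
    rw [Complex.mem_slitPlane_iff]
    by_cases hzy : z.im = y
    · left
      have hz' : z.re ∉ Icc p q := fun h ↦ (hRK z hz).2 ⟨hzy, h⟩
      rw [hre]
      refine div_pos ?_ (hnQ (Or.inl hz))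
      rw [mem_Icc, not_and_or, not_le, not_le] at hz'
      rcases hz' with h | h <;> nlinarith
    · right
      rw [him]
      exact div_ne_zero (mul_ne_zero hpq.ne (sub_ne_zero.2 hzy)) (hnQ (Or.inl hz)).ne'
  have hsT : ∀ z ∈ T, -f z ∈ Complex.slitPlane := by
    intro z hz
    rw [Complex.mem_slitPlane_iff, Complex.neg_re, Complex.neg_im, neg_ne_zero]
    by_cases hzy : z.im = y
    · left
      rw [hre, ← neg_div]
      refine div_pos ?_ (hnQ (Or.inr hz))
      obtain ⟨t, -, rfl⟩ := hz
      simp only at hzy ⊢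
      rw [hzy]
      nlinarith [mul_pos (sub_pos.2 hpx) (sub_pos.2 hxq)]
    · right
      rw [him]
      exact div_ne_zero (mul_ne_zero hpq.ne (sub_ne_zero.2 hzy)) (hnQ (Or.inr hz)).ne'
  have haR : a ∈ R := ⟨0, by simp⟩
  have hbR : b ∈ R := ⟨1, by simp⟩
  have hy : y₁ ≤ y₂ := (h₁.trans h₂).le
  have haT : a ∈ T := ⟨y₁, left_mem_Icc.2 hy, rfl⟩
  have hbT : b ∈ T := ⟨y₂, right_mem_Icc.2 hy, rfl⟩
  have e1 := hRc.sub_eq_sub_of_exp_eq (hLc.mono subset_union_left)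
    ((hf.mono subset_union_left).clog hsR)
    ⟨1, fun z hz ↦ by rw [hL z (Or.inl hz), Complex.exp_log (hf0 (Or.inl hz)), one_mul]⟩ haR hbR
  have e2 := hTc.sub_eq_sub_of_exp_eq (hLc.mono subset_union_right)
    ((hf.mono subset_union_right).neg.clog hsT)
    ⟨-1, fun z hz ↦ by
      rw [hL z (Or.inr hz), Pi.neg_apply, Complex.exp_log (neg_ne_zero.2 (hf0 (Or.inr hz))),
        neg_one_mul,
        neg_neg]⟩ haT hbT
  have ha : 0 < (f a).im := by
    rw [him]
    exact div_pos (mul_pos_of_neg_of_neg hpq (sub_neg.2 h₁)) (hnQ (Or.inl haR))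
  have hb : (f b).im < 0 := by
    rw [him]
    exact div_neg_of_neg_of_pos (mul_neg_of_neg_of_pos hpq (sub_pos.2 h₂)) (hnQ (Or.inl hbR))
  have i1 := congrArg Complex.im e1
  have i2 := congrArg Complex.im e2
  simp only [Complex.sub_im, Complex.log_im, Pi.neg_apply] at i1 i2
  rw [Complex.arg_neg_eq_arg_sub_pi_of_im_pos ha, Complex.arg_neg_eq_arg_add_pi_of_im_neg hb] at i2
  linarith [Real.pi_pos]

end Crosscut

section Runs

variable {U : Set ℂ} {δ : ℝ}

/-- The abscissas `x` for which the closed vertical segment spanning the `j`-th horizontal strip of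
height `δ` above `x` lies in `U`. -/
def columns (U : Set ℂ) (δ : ℝ) (j : ℤ) : Set ℝ :=
  {x | ∀ y ∈ Icc (j * δ) ((j + 1) * δ), (⟨x, y⟩ : ℂ) ∈ U}

/-- A run is a connected component of the set of columns of some strip. -/
def Run (U : Set ℂ) (δ : ℝ) : Type :=
  {p : ℤ × Set ℝ // ∃ x ∈ columns U δ p.1, p.2 = connectedComponentIn (columns U δ p.1) x}

namespace Run

/-- The strip containing a run. -/
def row (u : Run U δ) : ℤ := u.1.1

/-- The interval of abscissas of a run. -/
def base (u : Run U δ) : Set ℝ := u.1.2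

/-- The rectangle occupied by a run. -/
def rect (u : Run U δ) : Set ℂ :=
  {z | z.re ∈ u.base ∧ z.im ∈ Icc (u.row * δ) ((u.row + 1) * δ)}

theorem isOpen_columns (hU : IsOpen U) (j : ℤ) : IsOpen (columns U δ j) := by
  have hc : Continuous fun p : ℝ × ℝ ↦ (⟨p.1, p.2⟩ : ℂ) :=
    Complex.equivRealProdCLM.symm.continuous
  refine isOpen_iff_eventually.2 fun x hx ↦ ?_
  refine isCompact_Icc.eventually_forall_of_forall_eventually fun y hy ↦ ?_
  exact hc.continuousAt.eventually (hU.mem_nhds (hx y hy))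

theorem exists_base_eq (u : Run U δ) :
    ∃ x ∈ columns U δ u.row, u.base = connectedComponentIn (columns U δ u.row) x :=
  u.2

theorem base_subset (u : Run U δ) : u.base ⊆ columns U δ u.row := by
  obtain ⟨x, _, hu⟩ := u.exists_base_eq
  exact hu ▸ connectedComponentIn_subset _ _

theorem isOpen_base (hU : IsOpen U) (u : Run U δ) : IsOpen u.base := by
  obtain ⟨x, _, hu⟩ := u.exists_base_eq
  exact hu ▸ (isOpen_columns hU _).connectedComponentIn

theorem isConnected_base (u : Run U δ) : IsConnected u.base := by
  obtain ⟨x, hx, hu⟩ := u.exists_base_eq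
  exact hu ▸ isConnected_connectedComponentIn_iff.2 hx

theorem base_eq {u : Run U δ} {x : ℝ} (hx : x ∈ u.base) :
    u.base = connectedComponentIn (columns U δ u.row) x := by
  obtain ⟨x', hx', hu⟩ := u.exists_base_eq
  rw [hu] at hx
  exact hu.trans (connectedComponentIn_eq hx)

theorem eq_of_row_eq {u v : Run U δ} (h : u.row = v.row) {x : ℝ} (hu : x ∈ u.base)
    (hv : x ∈ v.base) : u = v :=
  Subtype.ext <| Prod.ext h <| (base_eq hu).trans <| h ▸ (base_eq hv).symm

theorem subset_base (u : Run U δ) {x : ℝ} (hx : x ∈ u.base) {s : Set ℝ} (hs : IsPreconnected s)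
    (hxs : x ∈ s) (h : s ⊆ columns U δ u.row) : s ⊆ u.base :=
  base_eq hx ▸ hs.subset_connectedComponentIn hxs h

theorem mem_base_of_mem_closure (hU : IsOpen U) (u : Run U δ) {x : ℝ} (hx : x ∈ closure u.base)
    (h : x ∈ columns U δ u.row) : x ∈ u.base := by
  obtain ⟨y, hy, hyu⟩ := mem_closure_iff.1 hx _ (isOpen_columns hU _).connectedComponentIn
    (mem_connectedComponentIn h)
  rw [base_eq hyu, ← connectedComponentIn_eq hy]
  exact mem_connectedComponentIn h

theorem exists_mem_rect {j : ℤ} {z : ℂ} (hz : z.im ∈ Icc (j * δ) ((j + 1) * δ))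
    (hx : z.re ∈ columns U δ j) : ∃ u : Run U δ, z ∈ u.rect :=
  ⟨⟨(j, _), _, hx, rfl⟩, mem_connectedComponentIn hx, hz⟩

theorem rect_subset (u : Run U δ) : u.rect ⊆ U := fun _ hz ↦ u.base_subset hz.1 _ hz.2

theorem convex_rect (u : Run U δ) : Convex ℝ u.rect := by
  have h : u.rect = Complex.reLm ⁻¹' u.base ∩
      Complex.imLm ⁻¹' Icc (u.row * δ) ((u.row + 1) * δ) := rfl
  rw [h]
  exact (u.isConnected_base.isPreconnected.ordConnected.convex.linear_preimage _).inter
    ((convex_Icc _ _).linear_preimage _)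

theorem rect_nonempty (hδ : 0 < δ) (u : Run U δ) : u.rect.Nonempty := by
  obtain ⟨x, hx⟩ := u.isConnected_base.nonempty
  exact ⟨⟨x, u.row * δ⟩, hx, le_rfl, by dsimp; nlinarith⟩

/-- The nerve of the family of rectangles of runs. -/
def nerve (U : Set ℂ) (δ : ℝ) : SimpleGraph (Run U δ) where
  Adj u v := u ≠ v ∧ (u.rect ∩ v.rect).Nonempty
  symm := ⟨fun u v h ↦ ⟨h.1.symm, inter_comm u.rect v.rect ▸ h.2⟩⟩
  loopless := ⟨fun _ h ↦ h.1 rfl⟩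

theorem row_of_adj (hδ : 0 < δ) {u v : Run U δ} (h : (nerve U δ).Adj u v) :
    v.row = u.row + 1 ∨ u.row = v.row + 1 := by
  obtain ⟨hne, z, ⟨hzu, hz₁, hz₂⟩, hzv, hz₃, hz₄⟩ := h
  have h₁ : u.row ≤ v.row + 1 := by
    exact_mod_cast le_of_mul_le_mul_right (hz₁.trans hz₄) hδ
  have h₂ : v.row ≤ u.row + 1 := by
    exact_mod_cast le_of_mul_le_mul_right (hz₃.trans hz₂) hδ
  have h₃ : u.row ≠ v.row := fun h ↦ hne (eq_of_row_eq h hzu hzv)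
  lia

/-- The complement of `U` together with all vertical segments, spanning a strip, that leave `U`. -/
def obstacle (U : Set ℂ) (δ : ℝ) : Set ℂ :=
  Uᶜ ∪ {z | ∃ j : ℤ, z.re ∉ columns U δ j ∧ z.im ∈ Icc (j * δ) ((j + 1) * δ)}

theorem isPreconnected_obstacle (hU : IsPreconnected Uᶜ) : IsPreconnected (obstacle U δ) := by
  rcases Uᶜ.eq_empty_or_nonempty with h0 | ⟨w, hw⟩
  · have : obstacle U δ = ∅ := by
      have h0 : U = univ := compl_empty_iff.1 h0
      simp [obstacle, columns, h0]
    exact this ▸ isPreconnected_empty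
  refine isPreconnected_of_forall w fun z hz ↦ ?_
  rcases hz with hz | ⟨j, hz, hj⟩
  · exact ⟨Uᶜ, subset_union_left, hw, hz, hU⟩
  obtain ⟨y, hy, hyU⟩ : ∃ y ∈ Icc (j * δ) ((j + 1) * δ), (⟨z.re, y⟩ : ℂ) ∈ Uᶜ := by
    simpa [columns, and_assoc] using hz
  have hc : Continuous fun y : ℝ ↦ (⟨z.re, y⟩ : ℂ) :=
    Complex.equivRealProdCLM.symm.continuous.comp (by fun_prop : Continuous fun y ↦ (z.re, y))
  refine ⟨Uᶜ ∪ (fun y : ℝ ↦ (⟨z.re, y⟩ : ℂ)) '' Icc (j * δ) ((j + 1) * δ), ?_, .inl hw,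
    .inr ⟨z.im, hj, rfl⟩, ?_⟩
  · rintro _ (h | ⟨t, ht, rfl⟩)
    exacts [.inl h, .inr ⟨j, hz, ht⟩]
  · exact hU.union _ hyU ⟨y, hy, rfl⟩ (isPreconnected_Icc.image _ hc.continuousOn)

theorem notMem_obstacle {z : ℂ} (hz : z ∈ U)
    (h : ∀ j : ℤ, z.im ∈ Icc (j * δ) ((j + 1) * δ) → z.re ∈ columns U δ j) :
    z ∉ obstacle U δ := by
  rintro (h' | ⟨j, hj, hj'⟩)
  exacts [h' hz, hj (h j hj')]

theorem notMem_obstacle_of_row_eq (hδ : 0 < δ) {u v : Run U δ} (huv : v.row = u.row + 1) {x : ℝ}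
    (hxu : x ∈ u.base) (hxv : x ∈ v.base) {t : ℝ}
    (ht : t ∈ Icc ((u.row + 1 / 2) * δ) ((v.row + 1 / 2) * δ)) : (⟨x, t⟩ : ℂ) ∉ obstacle U δ := by
  have hv : (v.row : ℝ) = u.row + 1 := by exact_mod_cast huv
  obtain ⟨ht₁, ht₂⟩ := ht
  rw [hv] at ht₂
  refine notMem_obstacle ?_ fun j hj ↦ ?_
  · rcases le_total t ((u.row + 1) * δ) with h | h
    · exact u.base_subset hxu t ⟨by nlinarith, h⟩
    · exact v.base_subset hxv t ⟨by rw [hv]; exact h, by rw [hv]; nlinarith⟩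
  · have h₁ : (u.row : ℝ) + 1 / 2 ≤ j + 1 := le_of_mul_le_mul_right (ht₁.trans hj.2) hδ
    have h₂ : (j : ℝ) ≤ u.row + 1 + 1 / 2 := le_of_mul_le_mul_right (hj.1.trans ht₂) hδ
    have h₃ : u.row < j + 1 := by exact_mod_cast (by linarith : (u.row : ℝ) < j + 1)
    have h₄ : j < u.row + 2 := by exact_mod_cast (by linarith : (j : ℝ) < u.row + 2)
    obtain rfl | rfl : j = u.row ∨ j = v.row := by lia
    exacts [u.base_subset hxu, v.base_subset hxv]

theorem notMem_obstacle_mid (hδ : 0 < δ) {u : Run U δ} {x : ℝ} (hx : x ∈ u.base) :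
    (⟨x, (u.row + 1 / 2) * δ⟩ : ℂ) ∉ obstacle U δ := by
  refine notMem_obstacle (u.base_subset hx _ ⟨by nlinarith, by nlinarith⟩) fun j hj ↦ ?_
  have h₁ : (u.row : ℝ) + 1 / 2 ≤ j + 1 := le_of_mul_le_mul_right hj.2 hδ
  have h₂ : (j : ℝ) ≤ u.row + 1 / 2 := le_of_mul_le_mul_right hj.1 hδ
  have h₃ : u.row < j + 1 := by exact_mod_cast (by linarith : (u.row : ℝ) < j + 1)
  have h₄ : j < u.row + 1 := by exact_mod_cast (by linarith : (j : ℝ) < u.row + 1)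
  obtain rfl : j = u.row := by lia
  exact u.base_subset hx

theorem joinedIn_mid (hδ : 0 < δ) {u : Run U δ} {x x' : ℝ} (hx : x ∈ u.base) (hx' : x' ∈ u.base)
    (k : ℤ) (s : Set ℝ) :
    JoinedIn {z | z ∉ obstacle U δ ∧ ¬ (z.im = (k + 1) * δ ∧ z.re ∈ s)}
      ⟨x, (u.row + 1 / 2) * δ⟩ ⟨x', (u.row + 1 / 2) * δ⟩ := by
  have hconv : Convex ℝ (Complex.reLm ⁻¹' u.base ∩ Complex.imLm ⁻¹' {(u.row + 1 / 2) * δ}) :=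
    (u.isConnected_base.isPreconnected.ordConnected.convex.linear_preimage _).inter
      ((convex_singleton _).linear_preimage _)
  refine JoinedIn.of_segment_subset fun z hz ↦ ?_
  obtain ⟨hz₁, hz₂⟩ := hconv.segment_subset ⟨hx, rfl⟩ ⟨hx', rfl⟩ hz
  obtain ⟨a, b⟩ := z
  simp only [mem_preimage, Complex.reLm_coe, Complex.imLm_coe, mem_singleton_iff] at hz₁ hz₂
  subst hz₂
  refine ⟨notMem_obstacle_mid hδ hz₁, fun h ↦ ?_⟩
  have h₁ : (u.row : ℝ) + 1 / 2 = k + 1 := mul_right_cancel₀ hδ.ne' h.1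
  have h₂ : 2 * u.row + 1 = 2 * k + 2 := by
    exact_mod_cast (by linarith : (2 : ℝ) * u.row + 1 = 2 * k + 2)
  lia

theorem joinedIn_of_row_eq (hδ : 0 < δ) (hU : IsOpen U) {u v a c : Run U δ}
    (huv : v.row = u.row + 1) (hac : c.row = a.row + 1) (hne : s(a, c) ≠ s(u, v)) {x : ℝ}
    (hxa : x ∈ a.base) (hxc : x ∈ c.base) {s : Set ℝ} (hs : s ⊆ closure (u.base ∩ v.base)) :
    JoinedIn {z | z ∉ obstacle U δ ∧ ¬ (z.im = (u.row + 1) * δ ∧ z.re ∈ s)}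
      ⟨x, (a.row + 1 / 2) * δ⟩ ⟨x, (c.row + 1 / 2) * δ⟩ := by
  have hc : (c.row : ℝ) = a.row + 1 := by exact_mod_cast hac
  have hconv : Convex ℝ (Complex.reLm ⁻¹' {x} ∩
      Complex.imLm ⁻¹' Icc ((a.row + 1 / 2) * δ) ((c.row + 1 / 2) * δ)) :=
    ((convex_singleton _).linear_preimage _).inter ((convex_Icc _ _).linear_preimage _)
  have hle : (a.row + 1 / 2) * δ ≤ (c.row + 1 / 2) * δ := by rw [hc]; nlinarith
  refine JoinedIn.of_segment_subset fun z hz ↦ ?_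
  obtain ⟨hz₁, hz₂⟩ := hconv.segment_subset ⟨rfl, left_mem_Icc.2 hle⟩ ⟨rfl, right_mem_Icc.2 hle⟩ hz
  obtain ⟨a', b⟩ := z
  simp only [mem_preimage, Complex.reLm_coe, Complex.imLm_coe, mem_singleton_iff] at hz₁ hz₂
  subst hz₁
  refine ⟨notMem_obstacle_of_row_eq hδ hac hxa hxc hz₂, fun h ↦ hne ?_⟩
  obtain ⟨h₁, h₂⟩ := h
  dsimp only at h₁ h₂
  rw [h₁] at hz₂
  have h₃ := le_of_mul_le_mul_right hz₂.1 hδ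
  have h₄ := le_of_mul_le_mul_right hz₂.2 hδ
  have h₅ : a.row < u.row + 1 := by exact_mod_cast (by linarith : (a.row : ℝ) < u.row + 1)
  have h₆ : u.row < a.row + 1 := by exact_mod_cast (by linarith : (u.row : ℝ) < a.row + 1)
  have hau : a.row = u.row := by lia
  have hcv : c.row = v.row := by lia
  have hxu : a' ∈ u.base := mem_base_of_mem_closure hU u
    (closure_mono inter_subset_left (hs h₂)) (hau ▸ a.base_subset hxa)
  have hxv : a' ∈ v.base := mem_base_of_mem_closure hU v
    (closure_mono inter_subset_right (hs h₂)) (hcv ▸ c.base_subset hxc)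
  rw [eq_of_row_eq hau hxa hxu, eq_of_row_eq hcv hxc hxv]

theorem joinedIn_of_reachable (hδ : 0 < δ) (hU : IsOpen U) {u v a b : Run U δ}
    (huv : v.row = u.row + 1) (h : ((nerve U δ).deleteEdges {s(u, v)}).Reachable a b)
    {s : Set ℝ} (hs : s ⊆ closure (u.base ∩ v.base)) {x x' : ℝ} (hx : x ∈ a.base)
    (hx' : x' ∈ b.base) :
    JoinedIn {z | z ∉ obstacle U δ ∧ ¬ (z.im = (u.row + 1) * δ ∧ z.re ∈ s)}
      ⟨x, (a.row + 1 / 2) * δ⟩ ⟨x', (b.row + 1 / 2) * δ⟩ := by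
  obtain ⟨w⟩ := h
  induction w generalizing x with
  | nil => exact joinedIn_mid hδ hx hx' _ _
  | cons hadj _ ih =>
    rw [SimpleGraph.deleteEdges_adj] at hadj
    obtain ⟨hadj, hne⟩ := hadj
    obtain ⟨z, ⟨hza, -⟩, hzc, -⟩ := hadj.2
    refine ((joinedIn_mid hδ hx hza _ _).trans ?_).trans (ih hzc hx')
    rcases row_of_adj hδ hadj with h | h
    · exact joinedIn_of_row_eq hδ hU huv h hne hza hzc hs
    · exact (joinedIn_of_row_eq hδ hU huv h (fun h ↦ hne (Sym2.eq_swap.trans h)) hzc hza hs).symm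

theorem isBounded_base (hU : Bornology.IsBounded U) (hδ : 0 < δ) (u : Run U δ) :
    Bornology.IsBounded u.base := by
  obtain ⟨R, hR⟩ := hU.exists_norm_le
  refine isBounded_iff_forall_norm_le.2 ⟨R, fun x hx ↦ ?_⟩
  exact (Complex.abs_re_le_norm ⟨x, u.row * δ⟩).trans
    (hR _ (u.base_subset hx _ ⟨le_rfl, by nlinarith⟩))

theorem mem_obstacle (hU : IsOpen U) {u v : Run U δ} (hδ : 0 < δ)
    (huv : v.row = u.row + 1) {x : ℝ} (hx : x ∈ closure (u.base ∩ v.base))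
    (hx' : x ∉ u.base ∩ v.base) : (⟨x, (u.row + 1) * δ⟩ : ℂ) ∈ obstacle U δ := by
  have hv : (v.row : ℝ) = u.row + 1 := by exact_mod_cast huv
  by_contra h
  refine hx' ⟨mem_base_of_mem_closure hU u (closure_mono inter_subset_left hx) ?_,
    mem_base_of_mem_closure hU v (closure_mono inter_subset_right hx) ?_⟩
  · exact by_contra fun h' ↦ h (.inr ⟨u.row, h', by dsimp; nlinarith, le_rfl⟩)
  · exact by_contra fun h' ↦ h (.inr ⟨v.row, h', by rw [hv], by rw [hv]; dsimp; nlinarith⟩)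

theorem not_reachable_of_adj (hδ : 0 < δ) (hU : IsOpen U) (hb : Bornology.IsBounded U)
    (hc : IsPreconnected Uᶜ) {u v : Run U δ} (h : (nerve U δ).Adj u v)
    (huv : v.row = u.row + 1) : ¬ ((nerve U δ).deleteEdges {s(u, v)}).Reachable u v := by
  obtain ⟨z, ⟨hzu, -⟩, hzv, -⟩ := h.2
  have hv : (v.row : ℝ) = u.row + 1 := by exact_mod_cast huv
  set O := u.base ∩ v.base with hO
  have hOo : IsOpen O := (u.isOpen_base hU).inter (v.isOpen_base hU)
  have hzO : z.re ∈ O := ⟨hzu, hzv⟩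
  have hOb := (u.isBounded_base hb hδ).subset (inter_subset_left : O ⊆ u.base)
  have hl : sInf O ∈ closure O := csInf_mem_closure ⟨_, hzO⟩ hOb.bddBelow
  have hr : sSup O ∈ closure O := csSup_mem_closure ⟨_, hzO⟩ hOb.bddAbove
  have hl' : sInf O ∉ O := fun h' ↦ by
    obtain ⟨y, hy, hy'⟩ := exists_Ioc_subset_of_mem_nhds (hOo.mem_nhds h') (exists_lt _)
    obtain ⟨t, ht, ht'⟩ := exists_between hy
    exact ht'.not_ge (csInf_le hOb.bddBelow (hy' ⟨ht, ht'.le⟩))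
  have hr' : sSup O ∉ O := fun h' ↦ by
    obtain ⟨y, hy, hy'⟩ := exists_Ico_subset_of_mem_nhds (hOo.mem_nhds h') (exists_gt _)
    obtain ⟨t, ht, ht'⟩ := exists_between hy
    exact ht.not_ge (le_csSup hOb.bddAbove (hy' ⟨ht.le, ht'⟩))
  have hsub : Icc (sInf O) (sSup O) ⊆ closure O := by
    have hOc : OrdConnected (closure O) :=
      ((u.isConnected_base.isPreconnected.ordConnected.inter
        v.isConnected_base.isPreconnected.ordConnected).isPreconnected.closure).ordConnected
    exact hOc.out hl hr
  intro hreach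
  refine (isPreconnected_obstacle (δ := δ) hc).not_joinedIn_of_segment
    (mem_obstacle hU hδ huv hl hl') (mem_obstacle hU hδ huv hr hr')
    (lt_of_le_of_ne (csInf_le hOb.bddBelow hzO) fun h ↦ hl' (h ▸ hzO))
    (lt_of_le_of_ne (le_csSup hOb.bddAbove hzO) fun h ↦ hr' (h ▸ hzO)) ?_ ?_
    (fun t ht ↦ notMem_obstacle_of_row_eq hδ huv hzu hzv ht)
    (joinedIn_of_reachable hδ hU huv hreach hsub hzu hzv)
  · nlinarith
  · rw [hv]; nlinarith

theorem isAcyclic_nerve (hδ : 0 < δ) (hU : IsOpen U) (hb : Bornology.IsBounded U)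
    (hc : IsPreconnected Uᶜ) : (nerve U δ).IsAcyclic := by
  refine SimpleGraph.isAcyclic_iff_forall_adj_isBridge.2 fun u v h ↦ ?_
  rw [SimpleGraph.isBridge_iff]
  rcases row_of_adj hδ h with huv | huv
  · exact not_reachable_of_adj hδ hU hb hc h huv
  · rw [Sym2.eq_swap]
    exact fun hr ↦ not_reachable_of_adj hδ hU hb hc h.symm huv hr.symm

end Run
end Runs

theorem exists_pos_forall_abs_sub_lt_mem_Icc {δ : ℝ} (hδ : 0 < δ) (y : ℝ) :
    ∃ r > 0, ∀ (j : ℤ) (t : ℝ), |t - y| < r → t ∈ Icc (j * δ) ((j + 1) * δ) →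
      y ∈ Icc (j * δ) ((j + 1) * δ) := by
  set k := ⌊y / δ⌋
  have hk₁ : k * δ ≤ y := (le_div_iff₀ hδ).1 (Int.floor_le _)
  have hk₂ : y < (k + 1) * δ := (div_lt_iff₀ hδ).1 (Int.lt_floor_add_one _)
  rcases hk₁.eq_or_lt with h | h
  · refine ⟨δ, hδ, fun j t ht htj ↦ ?_⟩
    rw [abs_lt] at ht
    have h₁ : (j : ℝ) < k + 1 := lt_of_mul_lt_mul_right (by nlinarith [htj.1]) hδ.le
    have h₂ : (k : ℝ) < j + 2 := lt_of_mul_lt_mul_right (by nlinarith [htj.2]) hδ.le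
    have h₃ : (j : ℝ) ≤ k := by
      exact_mod_cast Int.lt_add_one_iff.1 (by exact_mod_cast h₁ : j < k + 1)
    have h₄ : (k : ℝ) ≤ j + 1 := by
      exact_mod_cast Int.lt_add_one_iff.1
        (by exact_mod_cast (by linarith : (k : ℝ) < j + 1 + 1) : k < j + 1 + 1)
    rw [← h]
    exact ⟨by gcongr, by gcongr⟩
  · refine ⟨min (y - k * δ) ((k + 1) * δ - y), lt_min (by linarith) (by linarith),
      fun j t ht htj ↦ ?_⟩
    rw [abs_lt] at ht
    have hl := min_le_left (y - k * δ) ((k + 1) * δ - y)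
    have hr := min_le_right (y - k * δ) ((k + 1) * δ - y)
    have h₁ : (j : ℝ) < k + 1 := lt_of_mul_lt_mul_right (by linarith [htj.1]) hδ.le
    have h₂ : (k : ℝ) < j + 1 := lt_of_mul_lt_mul_right (by linarith [htj.2]) hδ.le
    have h₃ : j < k + 1 := by exact_mod_cast h₁
    have h₄ : k < j + 1 := by exact_mod_cast h₂
    obtain rfl : j = k := by lia
    exact ⟨hk₁, hk₂.le⟩

theorem Convex.isSimplyConnected_preimage_val {E : Type*} [AddCommGroup E] [Module ℝ E]
    [TopologicalSpace E] [ContinuousAdd E] [ContinuousSMul ℝ E] {U T : Set E} (hT : Convex ℝ T)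
    (hne : T.Nonempty) (hTU : T ⊆ U) : IsSimplyConnected ((↑) ⁻¹' T : Set U) := by
  rw [← IsEmbedding.subtypeVal.isSimplyConnected_image, Subtype.image_preimage_coe,
    inter_eq_right.2 hTU]
  have := hT.contractibleSpace hne
  exact inferInstanceAs (SimplyConnectedSpace T)

theorem IsConnected.isSimplyConnected_of_isPreconnected_compl {U : Set ℂ} (hc : IsConnected U)
    (hU : IsOpen U) (hb : Bornology.IsBounded U) (hUc : IsPreconnected Uᶜ) :
    IsSimplyConnected U := by
  refine simply_connected_iff_loops_nullhomotopic.2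
    ⟨isPathConnected_iff_pathConnectedSpace.1 (hU.isConnected_iff_isPathConnected.1 hc),
      fun x α ↦ ?_⟩
  obtain ⟨ε, hε, hεU⟩ := (isCompact_range (continuous_subtype_val.comp
    α.continuous)).exists_cthickening_subset_open hU (range_subset_iff.2 fun t ↦ (α t).2)
  obtain ⟨δ, hδ, rfl⟩ : ∃ δ > 0, ε = 2 * δ := ⟨ε / 2, by positivity, by ring⟩
  have hnear : ∀ t (w : ℂ), |w.re - (α t : ℂ).re| ≤ δ → |w.im - (α t : ℂ).im| ≤ δ → w ∈ U := by
    intro t w h₁ h₂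
    refine hεU (Metric.mem_cthickening_of_dist_le w _ _ _ (mem_range_self t) ?_)
    rw [Complex.dist_eq]
    refine (Complex.norm_le_abs_re_add_abs_im _).trans ?_
    simp only [Function.comp_apply, Complex.sub_re, Complex.sub_im]
    linarith
  have hcol : ∀ t (j : ℤ) (a : ℝ), (α t : ℂ).im ∈ Icc (j * δ) ((j + 1) * δ) →
      |a - (α t : ℂ).re| ≤ δ → a ∈ columns U δ j := fun t j a hj ha y hy ↦
    hnear t _ ha <| abs_le.2 ⟨by dsimp; nlinarith [hy.1, hj.2], by dsimp; nlinarith [hy.2, hj.1]⟩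
  refine Path.homotopic_refl_of_isAcyclic_nerve (Run.isAcyclic_nerve hδ hU hb hUc)
    (D := fun u ↦ (↑) ⁻¹' u.rect) ?_ ?_ (fun u ↦ u.convex_rect.isSimplyConnected_preimage_val
      (u.rect_nonempty hδ) u.rect_subset) ?_ α ?_ ?_
  · rintro u v huv ⟨z, hzu, hzv⟩
    exact ⟨huv, z, hzu, hzv⟩
  · rintro u v ⟨-, z, hzu, hzv⟩
    exact ⟨⟨z, u.rect_subset hzu⟩, hzu, hzv⟩
  · rintro u v ⟨z, hzu, hzv⟩
    exact ((u.convex_rect.inter v.convex_rect).isSimplyConnected_preimage_val ⟨z, hzu, hzv⟩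
      (inter_subset_left.trans u.rect_subset)).isPathConnected
  · intro t
    have hj : (α t : ℂ).im ∈ Icc (⌊(α t : ℂ).im / δ⌋ * δ) ((⌊(α t : ℂ).im / δ⌋ + 1) * δ) :=
      ⟨(le_div_iff₀ hδ).1 (Int.floor_le _), ((div_lt_iff₀ hδ).1 (Int.lt_floor_add_one _)).le⟩
    exact Run.exists_mem_rect hj (hcol t _ _ hj (by simpa using hδ.le))
  · intro t
    obtain ⟨r, hr, hrt⟩ := exists_pos_forall_abs_sub_lt_mem_Icc hδ (α t : ℂ).im
    have hball : ∀ w ∈ Metric.ball (α t : ℂ) (min r δ),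
        |w.re - (α t : ℂ).re| < δ ∧ |w.im - (α t : ℂ).im| < min r δ := by
      intro w hw
      rw [Metric.mem_ball, Complex.dist_eq] at hw
      exact ⟨(Complex.abs_re_le_norm (w - α t)).trans_lt (hw.trans_le (min_le_right _ _)),
        (Complex.abs_im_le_norm (w - α t)).trans_lt hw⟩
    have hballU : Metric.ball (α t : ℂ) (min r δ) ⊆ U := fun w hw ↦
      hnear t w (hball w hw).1.le ((hball w hw).2.le.trans (min_le_right _ _))
    have hpos : 0 < min r δ := lt_min hr hδ
    refine ⟨Subtype.val ⁻¹' Metric.ball (α t : ℂ) (min r δ),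
      continuous_subtype_val.continuousAt.preimage_mem_nhds (Metric.ball_mem_nhds _ hpos),
      (convex_ball _ _).isSimplyConnected_preimage_val
      ⟨_, Metric.mem_ball_self hpos⟩ hballU, ?_⟩
    rintro u ⟨w, hwu, hw⟩
    refine ⟨?_, ((u.convex_rect.inter (convex_ball _ _)).isSimplyConnected_preimage_val
      ⟨w, hwu, hw⟩ (inter_subset_left.trans u.rect_subset)).isPathConnected⟩
    obtain ⟨h₁, h₂⟩ := hball w hw
    have hj := hrt u.row _ (h₂.trans_le (min_le_left _ _)) hwu.2
    refine ⟨u.subset_base hwu.1 (convex_closedBall (α t : ℂ).re δ).isPreconnected ?_ ?_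
      (Metric.mem_closedBall_self hδ.le), hj⟩
    · exact h₁.le
    · exact fun a ha ↦ hcol t _ a hj ha

theorem isPreconnected_compl_connectedComponentIn_compl {X : Type*} [TopologicalSpace X]
    [LocallyConnectedSpace X] [PreconnectedSpace X] {C : Set X} (hC : IsConnected C)
    (hCc : IsClosed C) (x : X) : IsPreconnected (connectedComponentIn Cᶜ x)ᶜ := by
  set Q := connectedComponentIn Cᶜ x with hQ
  have hCQ : C ⊆ Qᶜ := subset_compl_comm.1 (connectedComponentIn_subset _ _)
  obtain ⟨c, hc⟩ := hC.nonempty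
  refine isPreconnected_of_forall c fun y hy ↦ ?_
  by_cases hyC : y ∈ C
  · exact ⟨C, hCQ, hc, hyC, hC.isPreconnected⟩
  set E := connectedComponentIn Cᶜ y with hE
  have hEo : IsOpen E := hCc.isOpen_compl.connectedComponentIn
  have hyE : y ∈ E := mem_connectedComponentIn hyC
  have hdisj : Disjoint (closure E) Q := by
    refine Disjoint.closure_left (Set.disjoint_left.2 fun z hzE hzQ ↦ hy ?_)
      hCc.isOpen_compl.connectedComponentIn
    rw [hQ, connectedComponentIn_eq hzQ, ← connectedComponentIn_eq hzE]
    exact hyE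
  have hmeet : (closure E ∩ C).Nonempty := by
    rw [← not_disjoint_iff_nonempty_inter]
    intro h
    have hcl : closure E ⊆ E :=
      isPreconnected_connectedComponentIn.closure.subset_connectedComponentIn
        (subset_closure hyE) h.subset_compl_right
    have huniv : E = univ :=
      IsClopen.eq_univ ⟨closure_subset_iff_isClosed.1 hcl, hEo⟩ ⟨y, hyE⟩
    exact connectedComponentIn_subset _ _ (huniv ▸ mem_univ c : c ∈ E) hc
  obtain ⟨z, hzE, hzC⟩ := hmeet
  exact ⟨closure E ∪ C, union_subset hdisj.subset_compl_right hCQ, .inr hc,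
    .inl (subset_closure hyE),
    isPreconnected_connectedComponentIn.closure.union z hzE hzC hC.isPreconnected⟩

theorem Complex.isPreconnected_compl_ball (r : ℝ) :
    IsPreconnected (Metric.ball (0 : ℂ) r)ᶜ := by
  rcases le_or_gt r 0 with hr | hr
  · rw [Metric.ball_eq_empty.2 hr, compl_empty]
    exact isPreconnected_univ
  have h : (Metric.ball (0 : ℂ) r)ᶜ =
      (fun p : ℝ × ℝ ↦ (p.1 : ℂ) * Complex.exp (p.2 * Complex.I)) '' (Ici r ×ˢ univ) := by
    ext z
    simp only [mem_compl_iff, mem_ball_zero_iff, not_lt]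
    constructor
    · exact fun hz ↦ ⟨(‖z‖, z.arg), ⟨hz, mem_univ _⟩, Complex.norm_mul_exp_arg_mul_I z⟩
    · rintro ⟨⟨s, θ⟩, ⟨hs, -⟩, rfl⟩
      simpa [Complex.norm_exp_ofReal_mul_I] using le_abs.2 (.inl hs)
  rw [h]
  exact (isPreconnected_Ici.prod isPreconnected_univ).image _ (by fun_prop)

theorem OpenPartialHomeomorph.isPreconnected_compl_image {X : Type*} [TopologicalSpace X]
    [T2Space X] (φ : OpenPartialHomeomorph X ℂ) {r : ℝ} (hφ : φ.target = Metric.ball 0 r)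
    {A : Set X} (hA : IsOpen A) (hAφ : A ⊆ φ.source) (hne : φ.source ≠ univ)
    (hAc : IsPreconnected Aᶜ) : IsPreconnected (φ '' A)ᶜ := by
  obtain ⟨v, hv⟩ := (ne_univ_iff_exists_notMem _).1 hne
  set U := φ '' A with hU
  have hUo : IsOpen U := φ.isOpen_image_of_subset_source hA hAφ
  have hUball : U ⊆ Metric.ball 0 r := hφ ▸ image_subset_iff.2 fun x hx ↦ φ.map_source (hAφ hx)
  have key : ∀ F₁ F₂ : Set ℂ, IsClosed F₁ → IsClosed F₂ → Uᶜ ⊆ F₁ ∪ F₂ → Uᶜ ∩ (F₁ ∩ F₂) = ∅ →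
      (Metric.ball 0 r)ᶜ ⊆ F₁ → Uᶜ ⊆ F₁ := by
    intro F₁ F₂ hF₁ hF₂ hcov hdisj hF
    have hPball : Uᶜ ∩ F₂ ⊆ Metric.ball 0 r := fun z hz ↦ by_contra fun h ↦
      (hdisj ▸ ⟨hz.1, hF h, hz.2⟩ : z ∈ (∅ : Set ℂ))
    have hPt : Uᶜ ∩ F₂ ⊆ φ.target := hφ ▸ hPball
    have hPc : IsCompact (Uᶜ ∩ F₂) := Metric.isCompact_of_isClosed_isBounded
      (hUo.isClosed_compl.inter hF₂) (Metric.isBounded_ball.subset hPball)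
    have hP'c : IsClosed (φ.symm '' (Uᶜ ∩ F₂)) :=
      (hPc.image_of_continuousOn (φ.continuousOn_symm.mono hPt)).isClosed
    have hOo : IsOpen (φ.source ∩ φ ⁻¹' (Uᶜ ∩ F₁)ᶜ) :=
      φ.isOpen_inter_preimage (hUo.isClosed_compl.inter hF₁).isOpen_compl
    have hsub := isPreconnected_iff_subset_of_disjoint_closed.1 hAc _ _ hP'c hOo.isClosed_compl
      ?_ ?_
    · rcases hsub with h | h
      · obtain ⟨z, hz, hzv⟩ := h fun hvA ↦ hv (hAφ hvA)
        exact absurd (hzv ▸ φ.map_target (hPt hz)) hv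
      · intro z hz
        rcases hcov hz with h₁ | h₂
        · exact h₁
        have hzt := hPt ⟨hz, h₂⟩
        have hzA : φ.symm z ∈ Aᶜ := fun hzA ↦ hz ⟨_, hzA, φ.right_inv hzt⟩
        by_contra hz₁
        refine h hzA ⟨φ.map_target hzt, fun h' ↦ hz₁ ?_⟩
        rw [φ.right_inv hzt] at h'
        exact h'.2
    · intro x hx
      by_cases hxO : x ∈ φ.source ∩ φ ⁻¹' (Uᶜ ∩ F₁)ᶜ
      · have hxU : φ x ∈ Uᶜ := by
          rintro ⟨y, hy, hyx⟩
          exact hx (φ.injOn (hAφ hy) hxO.1 hyx ▸ hy)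
        refine .inl ⟨φ x, ⟨hxU, (hcov hxU).resolve_left fun h ↦ hxO.2 ⟨hxU, h⟩⟩, φ.left_inv hxO.1⟩
      · exact .inr hxO
    · refine eq_empty_of_forall_notMem ?_
      rintro _ ⟨-, ⟨z, hz, rfl⟩, hz'⟩
      refine hz' ⟨φ.map_target (hPt hz), fun h ↦ ?_⟩
      rw [φ.right_inv (hPt hz)] at h
      exact (hdisj ▸ ⟨h.1, h.2, hz.2⟩ : z ∈ (∅ : Set ℂ))
  refine isPreconnected_iff_subset_of_disjoint_closed.2 fun F₁ F₂ hF₁ hF₂ hcov hdisj ↦ ?_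
  have hball := compl_subset_compl.2 hUball
  refine (isPreconnected_iff_subset_of_disjoint_closed.1 (Complex.isPreconnected_compl_ball r)
    F₁ F₂ hF₁ hF₂ (hball.trans hcov)
    (subset_eq_empty (inter_subset_inter_left _ hball) hdisj)).imp
    (key F₁ F₂ hF₁ hF₂ hcov hdisj) (key F₂ F₁ hF₂ hF₁ (union_comm F₁ F₂ ▸ hcov) ?_)
  rw [inter_comm F₂ F₁]
  exact hdisj

theorem isSimplyConnected_of_isPreconnected_compl_sphere
    {A : Set (Metric.sphere (0 : EuclideanSpace ℝ (Fin 3)) 1)} (hA : IsOpen A)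
    (hAc : IsConnected A) (hne : Aᶜ.Nonempty) (hc : IsPreconnected Aᶜ) : IsSimplyConnected A := by
  obtain ⟨v, hv⟩ := hne
  have : Fact (Module.finrank ℝ (EuclideanSpace ℝ (Fin 3)) = 2 + 1) := ⟨by simp⟩
  let φ := ((stereographic' 2 v).transHomeomorph
    Complex.orthonormalBasisOneI.repr.symm.toHomeomorph).trans
      (OpenPartialHomeomorph.univBall (0 : ℂ) 1)
  have hsource : φ.source = {v}ᶜ := by simp [φ, OpenPartialHomeomorph.univBall_source]
  have htarget : φ.target = Metric.ball 0 1 := by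
    simp [φ, OpenPartialHomeomorph.univBall_target]
  have hAφ : A ⊆ φ.source := hsource ▸ subset_compl_singleton_iff.2 hv
  have hball : φ '' A ⊆ Metric.ball 0 1 := by
    rw [← htarget, image_subset_iff]
    exact fun x hx ↦ φ.map_source (hAφ hx)
  have hU : IsSimplyConnected (φ '' A) :=
    IsConnected.isSimplyConnected_of_isPreconnected_compl
      (hAc.image _ (φ.continuousOn.mono hAφ)) (φ.isOpen_image_of_subset_source hA hAφ)
      (Metric.isBounded_ball.subset hball)
      (φ.isPreconnected_compl_image htarget hA hAφ (by simp [hsource]) hc)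
  exact (φ.homeomorphOfImageSubsetSource hAφ rfl).toHomotopyEquiv.simplyConnectedSpace_iff.2 hU

theorem IsClosedMap.isConnected_preimage {X Y : Type*} [TopologicalSpace X]
    [TopologicalSpace Y] {f : X → Y} (hf : IsClosedMap f) (hcont : Continuous f)
    (hfib : ∀ y, IsConnected (f ⁻¹' {y})) {s : Set Y} (hs : IsConnected s) :
    IsConnected (f ⁻¹' s) := by
  have hsurj : Function.Surjective f := fun y ↦ (hfib y).nonempty
  have hq : IsQuotientMap (s.restrictPreimage f) :=
    (hf.restrictPreimage s).isQuotientMap hcont.restrictPreimage (hsurj.restrictPreimage s)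
  have := isConnected_iff_connectedSpace.1 hs
  have huniv : IsConnected (s.restrictPreimage f ⁻¹' univ) := by
    refine hq.isCoinducing.isConnected_preimage_of_isClosed (fun y ↦ ?_)
      isClosed_univ isConnected_univ
    have hy : f ⁻¹' {y.1} ⊆ f ⁻¹' s := fun x hx ↦ by
      rw [mem_preimage, show f x = y from hx]
      exact y.2
    have hpre : s.restrictPreimage f ⁻¹' {y} = (↑) ⁻¹' (f ⁻¹' {y.1}) := by
      ext x
      simp [Subtype.ext_iff]
    rw [hpre]
    obtain ⟨x, hx⟩ := (hfib y).nonempty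
    refine ⟨⟨⟨x, hy hx⟩, hx⟩, ?_⟩
    rw [← IsInducing.subtypeVal.isPreconnected_image, Subtype.image_preimage_coe,
      inter_eq_right.2 hy]
    exact (hfib y).isPreconnected
  rw [preimage_univ] at huniv
  rw [← Subtype.range_coe (s := f ⁻¹' s), ← image_univ]
  exact huniv.image Subtype.val continuous_subtype_val.continuousOn

theorem EuclideanSpace.connectedSpace_sphere {n : ℕ} (hn : 2 ≤ n) :
    ConnectedSpace (Metric.sphere (0 : EuclideanSpace ℝ (Fin n)) 1) := by
  refine isConnected_iff_connectedSpace.1 (isConnected_sphere ?_ 0 zero_le_one)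
  rw [← Module.finrank_eq_rank, finrank_euclideanSpace_fin]
  exact_mod_cast hn

/-- Pre-cells are simply connected: for a monotone self-map `h` of the 2-sphere
and a Jordan domain `Q ⊆ S²` (a connected component of the complement of a Jordan
curve), the pre-cell `h⁻¹(Q)` is a nonempty open connected simply connected set. -/
theorem precell_simply_connected
    (h : (Metric.sphere (0 : EuclideanSpace ℝ (Fin 3)) 1) →
         (Metric.sphere (0 : EuclideanSpace ℝ (Fin 3)) 1))
    (hcont : Continuous h) (hsurj : Function.Surjective h)
    (hfib : ∀ b, IsConnected (h ⁻¹' {b}))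
    (Q : Set (Metric.sphere (0 : EuclideanSpace ℝ (Fin 3)) 1))
    (γ : (Metric.sphere (0 : EuclideanSpace ℝ (Fin 2)) 1) →
         (Metric.sphere (0 : EuclideanSpace ℝ (Fin 3)) 1))
    (hγcont : Continuous γ) (hγinj : Function.Injective γ)
    (hQ : ∃ x ∈ (Set.range γ)ᶜ, Q = connectedComponentIn (Set.range γ)ᶜ x) :
    (h ⁻¹' Q).Nonempty ∧ IsOpen (h ⁻¹' Q) ∧ IsConnected (h ⁻¹' Q) ∧
      SimplyConnectedSpace (h ⁻¹' Q) := by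
  obtain ⟨x, hx, rfl⟩ := hQ
  have : Fact (Module.finrank ℝ (EuclideanSpace ℝ (Fin 3)) = 2 + 1) := ⟨by simp⟩
  have := EuclideanSpace.connectedSpace_sphere (n := 2) le_rfl
  have := EuclideanSpace.connectedSpace_sphere (n := 3) (by norm_num)
  have : LocallyConnectedSpace (Metric.sphere (0 : EuclideanSpace ℝ (Fin 3)) 1) :=
    ChartedSpace.locallyConnectedSpace (EuclideanSpace ℝ (Fin 2)) _
  have hγ : IsConnected (range γ) := isConnected_range hγcont
  have hγc : IsClosed (range γ) := (isCompact_range hγcont).isClosed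
  have hQc : IsConnected (connectedComponentIn (range γ)ᶜ x)ᶜ :=
    ⟨hγ.nonempty.mono (subset_compl_comm.1 (connectedComponentIn_subset _ _)),
      isPreconnected_compl_connectedComponentIn_compl hγ hγc x⟩
  have hopen := hγc.isOpen_compl.connectedComponentIn (x := x) |>.preimage hcont
  have hconn := hcont.isClosedMap.isConnected_preimage hcont hfib
    (isConnected_connectedComponentIn_iff.2 hx)
  have hcompl := hcont.isClosedMap.isConnected_preimage hcont hfib hQc
  exact ⟨hconn.nonempty, hopen, hconn, isSimplyConnected_of_isPreconnected_compl_sphere hopen hconn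
    hcompl.nonempty hcompl.isPreconnected⟩
end
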